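/- arXiv:1608.02709 — 3 statements merged into one kernel-verified Lean document; each statement's English description precedes it below -/
import Mathlib

section
/- Let (F_1,…,F_m;k) be an instance of the hMaf problem satisfying the label-set isomorphism property, with S a minimum maximal sibling-set of the instance lying in F_1, |S| ≥ 3, and suppose there is an X-forest F_p and two labels x_1, x_2 ∈ S with |E^1_{F_p}(x_1,x_2)| ≥ 2 (Case 3.2). Then Branching Rule 3.2 — branch into three ways: [1] remove the edge incident to x_1 in all X-forests; [2] remove the edge incident to x_2 in all X-forests; [3] remove the edges of E^1_{F_i}(x_1,x_2) in every F_i for 2 ≤ i ≤ m — is safe, and it satisfies the recurrence relation T(k) ≤ 2T(k−1) + T(k−2). -/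
/-!
A formalization framework for the Maximum Agreement Forest problem on multiple
rooted multifurcating phylogenetic trees.

An `X`-forest is modeled (up to forced contraction and label-preserving
isomorphism) by the laminar family of the label-sets `L(v)` of its vertices:
every vertex `v` is identified with the set `L(v)` of labels at its leaf
descendants, components correspond to the maximal clusters, leaves to the
singleton clusters, and the edge between a non-root vertex `v` and its parent
is identified with the cluster `L(v)`.
-/

open Finset

noncomputable section
open scoped Classical

/-- A rooted multifurcating phylogenetic `X`-forest, described by the laminar
family of the label sets of its vertices. -/
structure XForest (X : Type*) where
  clusters : Finset (Finset X)
  nonempty_of_mem : ∀ s ∈ clusters, s.Nonempty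
  laminar : ∀ s ∈ clusters, ∀ t ∈ clusters, ¬Disjoint s t → s ⊆ t ∨ t ⊆ s
  singleton_mem : ∀ x : X, {x} ∈ clusters

namespace XForest

variable {X : Type*} [DecidableEq X] [Fintype X]

/-- The connected components of an `X`-forest: the maximal clusters.  The
component `C` is identified with its label set `L(C)`. -/
def components (F : XForest X) : Finset (Finset X) :=
  F.clusters.filter fun s => ∀ t ∈ F.clusters, ¬s ⊂ t

/-- The order of an `X`-forest: its number of connected components. -/
def ord (F : XForest X) : ℕ := F.components.card

/-- `c` is (the cluster of) a child of (the vertex with cluster) `p`. -/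
def IsChild (F : XForest X) (c p : Finset X) : Prop :=
  c ∈ F.clusters ∧ p ∈ F.clusters ∧ c ⊂ p ∧ ∀ t ∈ F.clusters, c ⊂ t → ¬t ⊂ p

/-- The family obtained from the laminar family `A` by removing, for every
`d ∈ D`, the edge between the vertex with cluster `d` and its parent. -/
def cutFam (A D : Finset (Finset X)) : Finset (Finset X) :=
  (A.image fun s => s \ (D.filter fun d => d ⊂ s).biUnion id).filter fun s => s.Nonempty

/-- The `X`-forest obtained from `F` by removing the edges above the clusters
in `D` (followed by forced contraction). -/
def cut (F : XForest X) (D : Finset (Finset X)) : XForest X where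
  clusters := cutFam F.clusters (D.filter fun d => d ∈ F.clusters)
  nonempty_of_mem := fun s hs => (Finset.mem_filter.mp hs).2
  laminar := by
    intro s' hs' t' ht' hnd
    set D' : Finset (Finset X) := D.filter fun d => d ∈ F.clusters with hD'def
    have hD'sub : ∀ d ∈ D', d ∈ F.clusters := fun d hd => (Finset.mem_filter.mp hd).2
    obtain ⟨hs'm, -⟩ := Finset.mem_filter.mp hs'
    obtain ⟨s, hs, rfl⟩ := Finset.mem_image.mp hs'm
    obtain ⟨ht'm, -⟩ := Finset.mem_filter.mp ht'
    obtain ⟨t, ht, rfl⟩ := Finset.mem_image.mp ht'm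
    obtain ⟨x, hxs, hxt⟩ := Finset.not_disjoint_iff.mp hnd
    have key : ∀ u ∈ F.clusters, ∀ w ∈ F.clusters, u ⊆ w →
        ∀ z, z ∈ u \ (D'.filter fun d => d ⊂ u).biUnion id →
          z ∈ w \ (D'.filter fun d => d ⊂ w).biUnion id →
          u \ (D'.filter fun d => d ⊂ u).biUnion id ⊆
            w \ (D'.filter fun d => d ⊂ w).biUnion id := by
      intro u hu w hw huw z hzu hzw y hy
      rw [Finset.mem_sdiff] at hy hzu hzw ⊢
      refine ⟨huw hy.1, ?_⟩
      intro hyU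
      rw [Finset.mem_biUnion] at hyU
      obtain ⟨d, hd, hyd⟩ := hyU
      rw [Finset.mem_filter] at hd
      have hdF : d ∈ F.clusters := hD'sub d hd.1
      have hdw : d ⊂ w := hd.2
      have hlam := F.laminar d hdF u hu (Finset.not_disjoint_iff.mpr ⟨y, hyd, hy.1⟩)
      rcases hlam with hdu | hud
      · by_cases hde : d = u
        · exact hzw.2 (Finset.mem_biUnion.mpr
            ⟨d, Finset.mem_filter.mpr ⟨hd.1, hdw⟩, hde ▸ hzu.1⟩)
        · have hss : d ⊂ u := Finset.ssubset_iff_subset_ne.mpr ⟨hdu, hde⟩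
          exact hy.2 (Finset.mem_biUnion.mpr
            ⟨d, Finset.mem_filter.mpr ⟨hd.1, hss⟩, hyd⟩)
      · exact hzw.2 (Finset.mem_biUnion.mpr
          ⟨d, Finset.mem_filter.mpr ⟨hd.1, hdw⟩, hud hzu.1⟩)
    have hxs' : x ∈ s ∧ x ∈ t := by
      constructor
      · exact (Finset.mem_sdiff.mp hxs).1
      · exact (Finset.mem_sdiff.mp hxt).1
    rcases F.laminar s hs t ht (Finset.not_disjoint_iff.mpr ⟨x, hxs'.1, hxs'.2⟩) with hst | hts
    · exact Or.inl (key s hs t ht hst x hxs hxt)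
    · exact Or.inr (key t ht s hs hts x hxt hxs)
  singleton_mem := by
    intro x
    have hU : ((D.filter fun d => d ∈ F.clusters).filter fun d => d ⊂ ({x} : Finset X)) = ∅ := by
      rw [Finset.filter_eq_empty_iff]
      intro d hd hss
      have hne := F.nonempty_of_mem d (Finset.mem_filter.mp hd).2
      rw [Finset.ssubset_singleton_iff.mp hss] at hne
      exact Finset.not_nonempty_empty hne
    refine Finset.mem_filter.mpr ⟨?_, Finset.singleton_nonempty x⟩
    refine Finset.mem_image.mpr ⟨{x}, F.singleton_mem x, ?_⟩
    rw [hU]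
    simp

/-- `G` is a subforest of `F` (up to forced contraction and label-preserving
isomorphism): `G` is obtained from `F` by removing a set of edges. -/
def IsSubforest (G F : XForest X) : Prop :=
  ∃ D ⊆ F.clusters, G.clusters = (F.cut D).clusters

/-- The edge of `F` between the vertex with cluster `c` and its parent is *in*
the forest `G` (i.e. it lies on a path of `F` connecting two labels that belong
to a common connected component of `G`). -/
def EdgeUsed (F : XForest X) (c : Finset X) (G : XForest X) : Prop :=
  ∃ x ∈ c, ∃ y, y ∉ c ∧ (∃ C ∈ F.components, x ∈ C ∧ y ∈ C) ∧
    ∃ D ∈ G.components, x ∈ D ∧ y ∈ D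

/-- The least common ancestor of the two labels `a` and `b` in `F` (given as
its cluster, i.e. as the label set `L(lca_F(a,b))`). -/
def lca2 (F : XForest X) (a b : X) : Finset X :=
  (F.clusters.filter fun s => a ∈ s ∧ b ∈ s).inf id

/-- The least common ancestor of the labels of `S` in `F` (given as its
cluster). -/
def lcaS (F : XForest X) (S : Finset X) : Finset X :=
  (F.clusters.filter fun s => S ⊆ s).inf id

/-- `E^1_F(a,b)`: the edges of `F` that are not on the path `P` connecting the
labels `a` and `b` but are incident to internal vertices of this path other
than `lca_F(a,b)` (each edge is identified with the cluster of its lower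
endpoint). -/
def E1 (F : XForest X) (a b : X) : Finset (Finset X) :=
  F.clusters.filter fun d => ∃ c ∈ F.clusters, F.IsChild d c ∧ c ⊂ F.lca2 a b ∧
    ((a ∈ c ∧ c ≠ {a} ∧ a ∉ d) ∨ (b ∈ c ∧ c ≠ {b} ∧ b ∉ d))

/-- `E^2_F(a,b)`: the edges incident to `lca_F(a,b)` other than the two edges
on the path connecting `a` and `b` and the edge to the parent of the lca. -/
def E2 (F : XForest X) (a b : X) : Finset (Finset X) :=
  F.clusters.filter fun d => F.IsChild d (F.lca2 a b) ∧ a ∉ d ∧ b ∉ d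

/-- `E_F(a,b) = E^1_F(a,b) ∪ E^2_F(a,b)`. -/
def Eset (F : XForest X) (a b : X) : Finset (Finset X) := F.E1 a b ∪ F.E2 a b

/-- `E^O_F(S)`: the edges between `lca_F(S)` and its children that are not
labels in `S`. -/
def EO (F : XForest X) (S : Finset X) : Finset (Finset X) :=
  F.clusters.filter fun d => F.IsChild d (F.lcaS S) ∧ ∀ x ∈ S, d ≠ {x}

/-- `S` is a maximal sibling set (MSS) of `F`: the leaves with labels in `S`
have a common parent `p` whose children are exactly the labels in `S`
(equivalently, `S` itself is a cluster all of whose proper subclusters are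
singletons). -/
def IsMSS (F : XForest X) (S : Finset X) : Prop :=
  S ∈ F.clusters ∧ 2 ≤ S.card ∧ ∀ c ∈ F.clusters, c ⊂ S → c.card = 1

/-- the labels in `S` are (pairwise) siblings in `F`, i.e., they have a common
parent. -/
def Siblings (F : XForest X) (S : Finset X) : Prop :=
  ∃ p ∈ F.clusters, ∀ x ∈ S, F.IsChild {x} p

/-- An `X`-forest is binary if each of its non-leaf vertices has exactly two
children. -/
def IsBinary (F : XForest X) : Prop :=
  ∀ s ∈ F.clusters, 2 ≤ s.card → ∃ c₁ c₂ : Finset X, c₁ ≠ c₂ ∧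
    F.IsChild c₁ s ∧ F.IsChild c₂ s ∧ ∀ c, F.IsChild c s → c = c₁ ∨ c = c₂

/-- `B` is a resolution of `F`: `F` can be obtained from `B` by contracting
internal edges. -/
def IsResolution (B F : XForest X) : Prop :=
  F.clusters ⊆ B.clusters ∧ B.components = F.components

/-- `G` is a binary subforest of `F`: `G` is binary and is a subforest of some
binary resolution of `F`. -/
def IsBinarySubforest (G F : XForest X) : Prop :=
  G.IsBinary ∧ ∃ B : XForest X, B.IsBinary ∧ IsResolution B F ∧ IsSubforest G B

end XForest

variable {X : Type*} [DecidableEq X] [Fintype X] {m : ℕ}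

/-- A hard agreement forest for the `X`-forests `Fs`. -/
def IsHAF (Fs : Fin m → XForest X) (G : XForest X) : Prop :=
  ∀ i, XForest.IsSubforest G (Fs i)

/-- A hard maximum agreement forest (hMAF) for the `X`-forests `Fs`. -/
def IsHMAF (Fs : Fin m → XForest X) (G : XForest X) : Prop :=
  IsHAF Fs G ∧ ∀ G', IsHAF Fs G' → G.ord ≤ G'.ord

/-- A soft agreement forest for the `X`-forests `Fs`. -/
def IsSAF (Fs : Fin m → XForest X) (G : XForest X) : Prop :=
  ∀ i, XForest.IsBinarySubforest G (Fs i)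

/-- A soft maximum agreement forest (sMAF) for the `X`-forests `Fs`. -/
def IsSMAF (Fs : Fin m → XForest X) (G : XForest X) : Prop :=
  IsSAF Fs G ∧ ∀ G', IsSAF Fs G' → G.ord ≤ G'.ord

/-- An instance `(F_1, …, F_m; k)` of the (hard or soft) Maf problem. -/
structure Inst (X : Type*) (m : ℕ) where
  F : Fin m → XForest X
  k : ℤ

namespace Inst

/-- the largest order of an `X`-forest in the instance. -/
def ordMax (I : Inst X m) : ℕ := Finset.univ.sup fun i => (I.F i).ord

/-- a solution of an instance of the hMaf problem: a hard agreement forest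
whose order is at most `ordMax + k`. -/
def IsSolution (I : Inst X m) (G : XForest X) : Prop :=
  IsHAF I.F G ∧ (G.ord : ℤ) ≤ (I.ordMax : ℤ) + I.k

/-- a yes-instance of the hMaf problem. -/
def IsYes (I : Inst X m) : Prop := ∃ G, I.IsSolution G

/-- a solution of an instance of the sMaf problem. -/
def IsSSolution (I : Inst X m) (G : XForest X) : Prop :=
  IsSAF I.F G ∧ (G.ord : ℤ) ≤ (I.ordMax : ℤ) + I.k

/-- a yes-instance of the sMaf problem. -/
def IsSYes (I : Inst X m) : Prop := ∃ G, I.IsSSolution G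

/-- `S` is a minimum maximal sibling set of the instance `I`, lying in the
`i`-th forest. -/
def MinMSS (I : Inst X m) (i : Fin m) (S : Finset X) : Prop :=
  (I.F i).IsMSS S ∧ ∀ j : Fin m, ∀ S' : Finset X, (I.F j).IsMSS S' → S.card ≤ S'.card

end Inst

/-- the new value of the parameter after removing one edge from the `j`-th
forest (the maximum order `ordMax + k` stays invariant). -/
def cutk (I : Inst X m) (j : Fin m) : ℤ :=
  if (I.F j).ord = I.ordMax then I.k - 1 else I.k

/-- Reduction Rule 1 is applicable on `Fj` relative to `Fi`, at the vertex `v`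
of `Fj` (whose parent edge is to be removed): there is a subset
`{C_1, …, C_t}` (`t ≥ 1`) of the components of `Fi` and a component `C` of
`Fj` containing a non-root vertex `v` with
`L(v) = L(C) ∩ (L(C_1) ∪ … ∪ L(C_t))`. -/
def RR1App (Fi Fj : XForest X) (v : Finset X) : Prop :=
  ∃ 𝒞 ⊆ Fi.components, 𝒞.Nonempty ∧
    ∃ C ∈ Fj.components, v ∈ Fj.clusters ∧ v ⊆ C ∧ (∃ t ∈ Fj.clusters, v ⊂ t) ∧
      v = C ∩ 𝒞.biUnion id

/-- One application of Reduction Rule 1 to the instance `I`, producing `I'`. -/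
def RR1Step (I I' : Inst X m) : Prop :=
  ∃ i j, i ≠ j ∧ ∃ v, RR1App (I.F i) (I.F j) v ∧
    I' = ⟨Function.update I.F j ((I.F j).cut {v}), cutk I j⟩

/-- Reduction Rule 1 is applicable somewhere on the instance `I`. -/
def RR1Applicable (I : Inst X m) : Prop :=
  ∃ i j, i ≠ j ∧ ∃ v, RR1App (I.F i) (I.F j) v

/-- `I'` is obtained from `I` by applying Reduction Rule 1 repeatedly until it
is no longer applicable. -/
def RR1Exhaust (I I' : Inst X m) : Prop :=
  Relation.ReflTransGen RR1Step I I' ∧ ¬RR1Applicable I'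

/-- The situation of Case 1 (Branching Rule 1) for `Fj` relative to `Fi`:
there is a component `C` of `Fi` and a vertex `v` of `Fj` with two children
`c₁, c₂` such that `L(c₁) ⊆ L(C)` and `L(c₂) ∩ L(C) = ∅`. -/
def BR1AppCore (Fi Fj : XForest X) (v c₁ c₂ : Finset X) : Prop :=
  ∃ C ∈ Fi.components, Fj.IsChild c₁ v ∧ Fj.IsChild c₂ v ∧ c₁ ≠ c₂ ∧
    c₁ ⊆ C ∧ c₂ ∩ C = ∅

/-- An application of Branching Rule 1 to the instance `I` (on the forest with
index `j`, relative to the forest with index `i`), branching into the two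
instances `I₁` (removing `[v,c₁]`) and `I₂` (removing `[v,c₂]`). -/
def BR1Branch (I : Inst X m) (i j : Fin m) (v c₁ c₂ : Finset X)
    (I₁ I₂ : Inst X m) : Prop :=
  i ≠ j ∧ BR1AppCore (I.F i) (I.F j) v c₁ c₂ ∧
    I₁ = ⟨Function.update I.F j ((I.F j).cut {c₁}), cutk I j⟩ ∧
    I₂ = ⟨Function.update I.F j ((I.F j).cut {c₂}), cutk I j⟩

/-- two `X`-forests satisfy the label-set isomorphism property. -/
def LabelIso (F F' : XForest X) : Prop := F.components = F'.components

/-- an instance satisfies the label-set isomorphism property. -/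
def InstLabelIso (I : Inst X m) : Prop := ∀ i j, LabelIso (I.F i) (I.F j)

/-- One computation path of the 2-BR-process on the forests with indices `p`
and `q`: repeatedly apply Branching Rule 1 between these two forests (choosing
one of the two branches) followed by an exhaustive application of Reduction
Rule 1, until the two forests satisfy the label-set isomorphism property.  The
natural number records the number of edges removed by Branching Rule 1 along
the path. -/
inductive TwoBRPath {X : Type*} [DecidableEq X] [Fintype X] {m : ℕ} (p q : Fin m) :
    Inst X m → Inst X m → ℕ → Prop
  | done (I : Inst X m) (h : LabelIso (I.F p) (I.F q)) : TwoBRPath p q I I 0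
  | step {I I₁ I₂ J K I' : Inst X m} {n : ℕ} {i j : Fin m} {v c₁ c₂ : Finset X}
      (hij : (i = p ∧ j = q) ∨ (i = q ∧ j = p))
      (hbr : BR1Branch I i j v c₁ c₂ I₁ I₂)
      (hpick : J = I₁ ∨ J = I₂)
      (hex : RR1Exhaust J K)
      (hrest : TwoBRPath p q K I' n) : TwoBRPath p q I I' (n + 1)

/-- `s` and `t` are the indices of two forests with the first and the second
largest orders in `I`. -/
def FirstSecond (I : Inst X m) (s t : Fin m) : Prop :=
  s ≠ t ∧ (∀ i, (I.F i).ord ≤ (I.F s).ord) ∧ ∀ i, i ≠ s → (I.F i).ord ≤ (I.F t).ord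

/-- One computation path of Stage 2 of the m-BR-process: repeatedly apply the
2-BR-process to two forests with first and second largest orders not
satisfying the label-set isomorphism property, until the whole instance
satisfies the label-set isomorphism property. -/
inductive MBRAux {X : Type*} [DecidableEq X] [Fintype X] {m : ℕ} :
    Inst X m → Inst X m → ℕ → Prop
  | done (I : Inst X m) (h : InstLabelIso I) : MBRAux I I 0
  | step {I J I' : Inst X m} {a b : ℕ} {s t : Fin m}
      (hst : FirstSecond I s t) (hni : ¬LabelIso (I.F s) (I.F t))
      (h2 : TwoBRPath s t I J a) (hrest : MBRAux J I' b) : MBRAux I I' (a + b)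

/-- One computation path of the m-BR-process on the instance `I`, ending at
the instance `I'`, along which `n` edges are removed by Branching Rule 1. -/
def MBRPath (I I' : Inst X m) (n : ℕ) : Prop :=
  ∃ J, RR1Exhaust I J ∧ MBRAux J I' n

/-- The full branching tree of the 2-BR-process on the forests with indices
`p` and `q`, producing the collection (list) of resulting instances, each
together with the number of edges removed by Branching Rule 1 on its
computation path. -/
inductive TwoBRTree {X : Type*} [DecidableEq X] [Fintype X] {m : ℕ} (p q : Fin m) :
    Inst X m → List (Inst X m × ℕ) → Prop
  | done (I : Inst X m) (h : LabelIso (I.F p) (I.F q)) : TwoBRTree p q I [(I, 0)]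
  | step {I I₁ I₂ K₁ K₂ : Inst X m} {L₁ L₂ : List (Inst X m × ℕ)}
      {i j : Fin m} {v c₁ c₂ : Finset X}
      (hij : (i = p ∧ j = q) ∨ (i = q ∧ j = p))
      (hbr : BR1Branch I i j v c₁ c₂ I₁ I₂)
      (he₁ : RR1Exhaust I₁ K₁) (he₂ : RR1Exhaust I₂ K₂)
      (h₁ : TwoBRTree p q K₁ L₁) (h₂ : TwoBRTree p q K₂ L₂) :
      TwoBRTree p q I ((L₁ ++ L₂).map fun x => (x.1, x.2 + 1))

/-- One step of Stage 2 of the m-BR-process on a collection of instances: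
replace an instance, in which two forests of first and second largest orders
do not satisfy the label-set isomorphism property, by the collection produced
by the 2-BR-process on those two forests. -/
inductive CollStep {X : Type*} [DecidableEq X] [Fintype X] {m : ℕ} :
    List (Inst X m × ℕ) → List (Inst X m × ℕ) → Prop
  | step {I : Inst X m} {n : ℕ} {A B L : List (Inst X m × ℕ)} {s t : Fin m}
      (hst : FirstSecond I s t) (hni : ¬LabelIso (I.F s) (I.F t))
      (h : TwoBRTree s t I L) :
      CollStep (A ++ (I, n) :: B) (A ++ L.map (fun y => (y.1, y.2 + n)) ++ B)

/-- The m-BR-process on the instance `I` produces the collection `L` of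
instances (each recorded with the number of edges removed by Branching Rule 1
on the path leading to it): Stage 1 applies Reduction Rule 1 exhaustively, and
Stage 2 repeatedly applies the 2-BR-process until every instance of the
collection satisfies the label-set isomorphism property. -/
def MBRTree (I : Inst X m) (L : List (Inst X m × ℕ)) : Prop :=
  ∃ J, RR1Exhaust I J ∧ Relation.ReflTransGen CollStep [(J, 0)] L ∧
    ∀ x ∈ L, InstLabelIso x.1

/-- The 2-edge distance property of an instance. -/
def TwoEdgeDist (I : Inst X m) : Prop :=
  ∃ (G : Inst X m) (E : Fin m → Finset (Finset X)),
    InstLabelIso G ∧ G.k = I.k + 1 ∧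
    (∀ i, E i ⊆ (G.F i).clusters) ∧ (∀ i, (E i).card ≤ 1) ∧
    (∀ i, ∀ v ∈ E i, ∃ t ∈ (G.F i).clusters, v ⊂ t) ∧
    (∀ i, (I.F i).clusters = ((G.F i).cut (E i)).clusters) ∧
    ∃ i j : Fin m, i < j ∧ ∃ vi ∈ E i, ∃ vj ∈ E j, vi ≠ vj

/-- A branching step producing instances with parameters `ks` from an instance
with parameter `k` satisfies the recurrence relation
`T(k) ≤ c₁·T(k-1) + c₂·T(k-2)`:  for every nonnegative monotone `T` satisfying
the recurrence, the sum of the `T`-values of the produced parameters is at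
most `T k`. -/
def RecBound (k : ℤ) (ks : List ℤ) (c₁ c₂ : ℕ) : Prop :=
  ∀ T : ℤ → ℝ, (∀ x, 0 ≤ T x) → Monotone T →
    (∀ x : ℤ, (c₁ : ℝ) * T (x - 1) + (c₂ : ℝ) * T (x - 2) ≤ T x) →
    (ks.map T).sum ≤ T k

end

namespace HelperMAF

open scoped Classical in
/-- what remains of the cluster `s` after removing the edges above `D`. -/
noncomputable def res {X : Type*} (D : Finset (Finset X)) (s : Finset X) : Finset X :=
  s.filter fun x => ∀ d ∈ D, d ⊂ s → x ∉ d

theorem mem_res {X : Type*} {D : Finset (Finset X)} {s : Finset X} {x : X} :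
    x ∈ res D s ↔ x ∈ s ∧ ∀ d ∈ D, d ⊂ s → x ∉ d := by
  unfold res; simp

section
variable {X : Type*} [DecidableEq X] [Fintype X]

theorem mem_cut {F : XForest X} {D : Finset (Finset X)} (hD : D ⊆ F.clusters) {t : Finset X} :
    t ∈ (F.cut D).clusters ↔ t.Nonempty ∧ ∃ s ∈ F.clusters, res D s = t := by
  have h : ∀ s : Finset X, (s \ ((D.filter fun d => d ∈ F.clusters).filter
      fun d => d ⊂ s).biUnion id) = res D s := by
    intro s
    ext x
    simp only [mem_res, Finset.mem_sdiff, Finset.mem_biUnion, Finset.mem_filter, id]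
    constructor
    · rintro ⟨h1, h2⟩
      exact ⟨h1, fun d hd hds hx => h2 ⟨d, ⟨⟨hd, hD hd⟩, hds⟩, hx⟩⟩
    · rintro ⟨h1, h2⟩
      refine ⟨h1, ?_⟩
      rintro ⟨d, ⟨⟨hd, -⟩, hds⟩, hx⟩
      exact h2 d hd hds hx
  simp only [XForest.cut, XForest.cutFam, Finset.mem_filter, Finset.mem_image]
  constructor
  · rintro ⟨⟨s, hs, rfl⟩, hne⟩
    refine ⟨hne, s, hs, ?_⟩
    rw [← h s]
  · rintro ⟨hne, s, hs, rfl⟩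
    refine ⟨⟨s, hs, ?_⟩, hne⟩
    rw [← h s]

theorem res_subset (D : Finset (Finset X)) (s : Finset X) : res D s ⊆ s :=
  fun _ hx => (mem_res.1 hx).1

theorem lam (F : XForest X) {s t : Finset X} (hs : s ∈ F.clusters) (ht : t ∈ F.clusters)
    {x : X} (hxs : x ∈ s) (hxt : x ∈ t) : s ⊆ t ∨ t ⊆ s :=
  F.laminar s hs t ht (Finset.not_disjoint_iff.mpr ⟨x, hxs, hxt⟩)

theorem lam' (F : XForest X) {s t : Finset X} (hs : s ∈ F.clusters) (ht : t ∈ F.clusters)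
    {x : X} (hxs : x ∈ s) (hxt : x ∈ t) : s ⊂ t ∨ t ⊆ s := by
  by_cases h : t ⊆ s
  · exact Or.inr h
  · exact Or.inl ⟨(lam F hs ht hxs hxt).resolve_right h, h⟩

/-- key monotonicity -/
theorem res_mono (F : XForest X) {D : Finset (Finset X)} (hD : D ⊆ F.clusters)
    {u w : Finset X} (hu : u ∈ F.clusters) (huw : u ⊆ w)
    {z : X} (hzu : z ∈ res D u) (hzw : z ∈ res D w) : res D u ⊆ res D w := by
  intro y hy
  rw [mem_res] at hy hzu hzw ⊢
  refine ⟨huw hy.1, fun d hd hdw hyd => ?_⟩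
  rcases lam' F (hD hd) hu hyd hy.1 with h | h
  · exact hy.2 d hd h hyd
  · exact hzw.2 d hd hdw (h hzu.1)

/-- cutting in two steps, pointwise -/
theorem res_res (F : XForest X) {D E D' DE : Finset (Finset X)} (hD : D ⊆ F.clusters)
    (hE : E ⊆ F.clusters) (hDE : ∀ d, d ∈ DE ↔ d ∈ D ∨ d ∈ E)
    (hD' : ∀ d', d' ∈ D' ↔ d'.Nonempty ∧ ∃ d ∈ D, res E d = d')
    {s : Finset X} (hs : s ∈ F.clusters) (hmin : ∀ d ∈ D, d ⊂ s → res E d ≠ res E s) :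
    res D' (res E s) = res DE s := by
  ext x
  constructor
  · intro hx
    obtain ⟨hx1, hx2⟩ := mem_res.1 hx
    obtain ⟨hx3, hx4⟩ := mem_res.1 hx1
    refine mem_res.2 ⟨hx3, fun d hd hds hxd => ?_⟩
    rcases (hDE d).1 hd with h | h
    · have hxd' : x ∈ res E d := mem_res.2 ⟨hxd, fun e he hed =>
        hx4 e he (hed.trans hds)⟩
      have hsub := res_mono F hE (hD h) hds.1 hxd' hx1
      exact hx2 _ ((hD' _).2 ⟨⟨x, hxd'⟩, d, h, rfl⟩)
        (Finset.ssubset_iff_subset_ne.2 ⟨hsub, hmin d h hds⟩) hxd'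
    · exact hx4 d h hds hxd
  · intro hx
    obtain ⟨hx1, hx2⟩ := mem_res.1 hx
    have hxE : x ∈ res E s := mem_res.2 ⟨hx1, fun e he => hx2 e ((hDE e).2 (Or.inr he))⟩
    refine mem_res.2 ⟨hxE, fun d' hd' hlt hxd' => ?_⟩
    obtain ⟨-, d, hd, rfl⟩ := (hD' d').1 hd'
    have hxd := res_subset _ _ hxd'
    rcases lam' F (hD hd) hs hxd hx1 with h | h
    · exact hx2 d ((hDE d).2 (Or.inl hd)) h hxd
    · exact hlt.2 (res_mono F hE hs h hxE hxd')

theorem cut_cut (F : XForest X) {D E D' DE : Finset (Finset X)} (hD : D ⊆ F.clusters)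
    (hE : E ⊆ F.clusters) (hDE : ∀ d, d ∈ DE ↔ d ∈ D ∨ d ∈ E)
    (hD' : ∀ d', d' ∈ D' ↔ d'.Nonempty ∧ ∃ d ∈ D, res E d = d') :
    (F.cut DE).clusters = ((F.cut E).cut D').clusters := by
  have hDEs : DE ⊆ F.clusters := by
    intro d hd
    rcases (hDE d).1 hd with h | h
    · exact hD h
    · exact hE h
  have hD's : D' ⊆ (F.cut E).clusters := by
    intro d' hd'
    obtain ⟨hne, d, hd, rfl⟩ := (hD' d').1 hd'
    exact (mem_cut hE).2 ⟨hne, d, hD hd, rfl⟩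
  ext t
  rw [mem_cut hDEs, mem_cut hD's]
  constructor
  · rintro ⟨hne, s, hs, rfl⟩
    refine ⟨hne, ?_⟩
    obtain ⟨z, hz⟩ := hne
    obtain ⟨hz1, hz2⟩ := mem_res.1 hz
    have hzE : z ∈ res E s := mem_res.2 ⟨hz1, fun e he => hz2 e ((hDE e).2 (Or.inr he))⟩
    refine ⟨res E s, (mem_cut hE).2 ⟨⟨z, hzE⟩, s, hs, rfl⟩, ?_⟩
    refine res_res F hD hE hDE hD' hs fun d hd hds heq => ?_
    exact hz2 d ((hDE d).2 (Or.inl hd)) hds (res_subset E d (heq ▸ hzE))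
  · rintro ⟨hne, u, hu, rfl⟩
    refine ⟨hne, ?_⟩
    obtain ⟨hune, s, hs, rfl⟩ := (mem_cut hE).1 hu
    classical
    obtain ⟨s0, hs0, hmin⟩ := Finset.exists_minimal
      (s := F.clusters.filter fun w => res E w = res E s) ⟨s, by simp [hs]⟩
    obtain ⟨hs0F, hs0e⟩ := Finset.mem_filter.1 hs0
    refine ⟨s0, hs0F, ?_⟩
    rw [← hs0e]
    refine (res_res F hD hE hDE hD' hs0F fun d hd hds heq => ?_).symm
    exact hds.2 (hmin (Finset.mem_filter.2 ⟨hD hd, heq.trans hs0e⟩) hds.1)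

theorem sub_trans_cut {F G : XForest X} {E : Finset (Finset X)} (hE : E ⊆ F.clusters)
    (h : XForest.IsSubforest G (F.cut E)) : XForest.IsSubforest G F := by
  classical
  obtain ⟨D', hD', hG⟩ := h
  have hDs : (F.clusters.filter fun d => res E d ∈ D') ⊆ F.clusters := Finset.filter_subset _ _
  refine ⟨(F.clusters.filter fun d => res E d ∈ D') ∪ E, Finset.union_subset hDs hE, ?_⟩
  rw [hG]
  refine (cut_cut F hDs hE (fun d => by simp) fun d' => ?_).symm
  constructor
  · intro hd'
    obtain ⟨hne, d, hd, rfl⟩ := (mem_cut hE).1 (hD' hd')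
    exact ⟨hne, d, Finset.mem_filter.2 ⟨hd, hd'⟩, rfl⟩
  · rintro ⟨-, d, hd, rfl⟩
    exact (Finset.mem_filter.1 hd).2

theorem sub_cut_of_union {F G : XForest X} {D E DE : Finset (Finset X)} (hD : D ⊆ F.clusters)
    (hE : E ⊆ F.clusters) (hDE : ∀ d, d ∈ DE ↔ d ∈ D ∨ d ∈ E)
    (hG : G.clusters = (F.cut DE).clusters) : XForest.IsSubforest G (F.cut E) := by
  classical
  have key : ∀ d', d' ∈ (D.image (res E)).filter (fun d' => d'.Nonempty) ↔
      d'.Nonempty ∧ ∃ d ∈ D, res E d = d' := by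
    intro d'; simp [and_comm]
  refine ⟨(D.image (res E)).filter (fun d' => d'.Nonempty), ?_, ?_⟩
  · intro d' hd'
    obtain ⟨hne, d, hd, rfl⟩ := (key d').1 hd'
    exact (mem_cut hE).2 ⟨hne, d, hD hd, rfl⟩
  · rw [hG]
    exact cut_cut F hD hE hDE key

theorem mem_comp {F : XForest X} {C : Finset X} :
    C ∈ F.components ↔ C ∈ F.clusters ∧ ∀ t ∈ F.clusters, ¬ C ⊂ t := by
  simp [XForest.components]

theorem exists_comp (F : XForest X) {s : Finset X} (hs : s ∈ F.clusters) :
    ∃ C ∈ F.components, s ⊆ C := by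
  obtain ⟨C, hsC, hC⟩ := F.clusters.exists_le_maximal hs
  exact ⟨C, mem_comp.2 ⟨hC.1, fun t ht hlt => hlt.2 (hC.2 ht hlt.1)⟩, hsC⟩

theorem sub_comp (F : XForest X) {C s : Finset X} (hC : C ∈ F.components)
    (hs : s ∈ F.clusters) {x : X} (hxC : x ∈ C) (hxs : x ∈ s) : s ⊆ C := by
  rw [mem_comp] at hC
  rcases lam' F hC.1 hs hxC hxs with h | h
  · exact absurd h (hC.2 s hs)
  · exact h

theorem comp_unique (F : XForest X) {C C' : Finset X} (hC : C ∈ F.components)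
    (hC' : C' ∈ F.components) {x : X} (hxC : x ∈ C) (hxs : x ∈ C') : C = C' :=
  (sub_comp F hC' (mem_comp.1 hC).1 hxs hxC).antisymm
    (sub_comp F hC (mem_comp.1 hC').1 hxC hxs)

theorem ord_lower {F H : XForest X} {R : Finset (Finset X)} (hR : R ⊆ H.components)
    (h : ∀ C ∈ F.components, ∃ K ∈ H.components, K ∉ R ∧ K ⊆ C) :
    F.ord + R.card ≤ H.ord := by
  classical
  choose! f hf1 hf2 hf3 using h
  have h1 : F.components.card ≤ (H.components \ R).card := by
    refine Finset.card_le_card_of_injOn f (fun C hC => ?_) ?_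
    · exact Finset.mem_coe.2 (Finset.mem_sdiff.2 ⟨hf1 C hC, hf2 C hC⟩)
    · intro C hC C' hC' heq
      obtain ⟨x, hx⟩ := H.nonempty_of_mem _ (mem_comp.1 (hf1 C hC)).1
      exact comp_unique F hC hC' (hf3 C hC hx) (hf3 C' hC' (heq ▸ hx))
  rw [Finset.card_sdiff_of_subset hR] at h1
  have h2 := Finset.card_le_card hR
  unfold XForest.ord
  omega

theorem sing_subset (F : XForest X) (x : X) : ({({x} : Finset X)} : Finset (Finset X)) ⊆ F.clusters := by
  intro d hd
  rw [Finset.mem_singleton.1 hd]; exact F.singleton_mem x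

theorem comp_of_cut_sub {F : XForest X} {E : Finset (Finset X)} (hE : E ⊆ F.clusters)
    {K C : Finset X} (hK : K ∈ (F.cut E).clusters) (hC : C ∈ F.components) {x : X}
    (hxK : x ∈ K) (hxC : x ∈ C) : K ⊆ C := by
  obtain ⟨-, s, hs, rfl⟩ := (mem_cut hE).1 hK
  exact (res_subset E s).trans (sub_comp F hC hs hxC (res_subset E s hxK))

theorem res_sing {x y : X} {s : Finset X} :
    y ∈ res {({x} : Finset X)} s ↔ y ∈ s ∧ (({x} : Finset X) ⊂ s → y ≠ x) := by
  simp [mem_res]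

theorem ord_cut_single (F : XForest X) {s : Finset X} {x : X} (hs : s ∈ F.clusters)
    (hlt : ({x} : Finset X) ⊂ s) : (F.cut {({x} : Finset X)}).ord = F.ord + 1 := by
  classical
  have hE := sing_subset F x
  have hx : ({x} : Finset X) ∈ (F.cut {({x} : Finset X)}).clusters :=
    (F.cut _).singleton_mem x
  -- the singleton is a component
  have hxc : ({x} : Finset X) ∈ (F.cut {({x} : Finset X)}).components := by
    refine mem_comp.2 ⟨hx, fun t ht hxt => ?_⟩
    obtain ⟨-, w, hw, rfl⟩ := (mem_cut hE).1 ht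
    have h1 : ({x} : Finset X) ⊂ w := lt_of_lt_of_le hxt (res_subset _ w)
    exact (res_sing.1 (hxt.1 (Finset.mem_singleton_self x))).2 h1 rfl
  have hCx : ∀ C ∈ F.components, ∃ y ∈ C, y ≠ x := by
    intro C hC
    by_contra hcon
    push Not at hcon
    obtain ⟨y, hy⟩ := F.nonempty_of_mem C (mem_comp.1 hC).1
    have hyx := hcon y hy
    subst hyx
    have := sub_comp F hC hs hy (hlt.1 (Finset.mem_singleton_self y))
    exact hlt.2 fun z hz => Finset.mem_singleton.2 (hcon z (this hz))
  apply le_antisymm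
  · have h2 : ((F.cut {({x} : Finset X)}).components.erase {x}).card ≤ F.components.card := by
      refine Finset.card_le_card_of_surjOn (fun C => res {({x} : Finset X)} C) ?_
      intro K hK
      obtain ⟨hKx, hK⟩ := Finset.mem_erase.1 (Finset.mem_coe.1 hK)
      have hKc := mem_comp.1 hK
      obtain ⟨⟨z, hz⟩, w, hw, rfl⟩ := (mem_cut hE).1 hKc.1
      obtain ⟨C, hC, hwC⟩ := exists_comp F hw
      refine ⟨C, hC, ?_⟩
      have hsub : res {({x} : Finset X)} w ⊆ res {({x} : Finset X)} C := by
        intro y hy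
        refine res_sing.2 ⟨hwC (res_subset _ _ hy), fun _ hyx => ?_⟩
        subst hyx
        apply hKx
        have hyw := res_sing.1 hy
        have hw' : w = {y} := by
          by_contra hne
          exact hyw.2 (Finset.ssubset_iff_subset_ne.2
            ⟨Finset.singleton_subset_iff.2 hyw.1, fun h => hne h.symm⟩) rfl
        ext v
        constructor
        · intro hv
          have := res_subset _ _ hv
          rwa [hw'] at this
        · intro hv
          rw [Finset.mem_singleton.1 hv]; exact hy
      have hCc : res {({x} : Finset X)} C ∈ (F.cut {({x} : Finset X)}).clusters :=
        (mem_cut hE).2 ⟨⟨z, hsub hz⟩, C, (mem_comp.1 hC).1, rfl⟩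
      by_contra hne
      exact hKc.2 _ hCc (Finset.ssubset_iff_subset_ne.2 ⟨hsub, fun h => hne h.symm⟩)
    rw [Finset.card_erase_of_mem hxc] at h2
    unfold XForest.ord
    omega
  · have := ord_lower (F := F) (H := F.cut {({x} : Finset X)}) (R := {{x}})
      (Finset.singleton_subset_iff.2 hxc) (fun C hC => ?_)
    · simpa using this
    · obtain ⟨y, hyC, hyx⟩ := hCx C hC
      obtain ⟨K, hK, hyK⟩ := exists_comp (F.cut {({x} : Finset X)}) ((F.cut _).singleton_mem y)
      have hyK := hyK (Finset.mem_singleton_self y)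
      refine ⟨K, hK, ?_, comp_of_cut_sub hE (mem_comp.1 hK).1 hC hyK hyC⟩
      intro h
      rw [Finset.mem_singleton.1 h, Finset.mem_singleton] at hyK
      exact hyx hyK

theorem mem_E1 {F : XForest X} {a b : X} {d : Finset X} :
    d ∈ F.E1 a b ↔ d ∈ F.clusters ∧ ∃ c ∈ F.clusters, F.IsChild d c ∧ c ⊂ F.lca2 a b ∧
    ((a ∈ c ∧ c ≠ {a} ∧ a ∉ d) ∨ (b ∈ c ∧ c ≠ {b} ∧ b ∉ d)) := by
  simp [XForest.E1]

theorem lca2_sub {F : XForest X} {a b : X} {s : Finset X} (hs : s ∈ F.clusters)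
    (ha : a ∈ s) (hb : b ∈ s) : F.lca2 a b ⊆ s := by
  unfold XForest.lca2
  exact Finset.inf_le (f := id) (by simp [hs, ha, hb])

/-- description of the edges in `E1`: they hang off a proper subpath. -/
theorem E1_desc {F : XForest X} {a b : X} {d : Finset X} (hd : d ∈ F.E1 a b) :
    ∃ c, F.IsChild d c ∧ a ∉ d ∧ b ∉ d ∧
      ((a ∈ c ∧ b ∉ c) ∨ (b ∈ c ∧ a ∉ c)) := by
  obtain ⟨hdF, c, hc, hch, hlt, h⟩ := mem_E1.1 hd
  have hnot : ¬ (a ∈ c ∧ b ∈ c) := fun h => hlt.2 (lca2_sub hc h.1 h.2)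
  refine ⟨c, hch, ?_⟩
  have hdc : d ⊆ c := hch.2.2.1.1
  rcases h with ⟨h1, -, h2⟩ | ⟨h1, -, h2⟩
  · have hb : b ∉ c := fun hb => hnot ⟨h1, hb⟩
    exact ⟨h2, fun h => hb (hdc h), Or.inl ⟨h1, hb⟩⟩
  · have ha : a ∉ c := fun ha => hnot ⟨ha, h1⟩
    exact ⟨fun h => ha (hdc h), h2, Or.inr ⟨h1, ha⟩⟩

theorem E1_subset (F : XForest X) (a b : X) : F.E1 a b ⊆ F.clusters :=
  fun _ hd => (mem_E1.1 hd).1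

/-- two hanging edges are disjoint -/
theorem E1_disj {F : XForest X} {a b : X} {d d' : Finset X} (hd : d ∈ F.E1 a b)
    (hd' : d' ∈ F.E1 a b) {y : X} (hy : y ∈ d) (hy' : y ∈ d') : d = d' := by
  have main : ∀ d d' : Finset X, d ∈ F.E1 a b → d' ∈ F.E1 a b → d ⊆ d' → d' ⊆ d := by
    intro d d' hd hd' hsub
    obtain ⟨c, ⟨hdF, hcF, hdc, hmax⟩, ha, hb, h⟩ := E1_desc hd
    obtain ⟨c', ⟨hdF', hcF', hdc', hmax'⟩, ha', hb', h'⟩ := E1_desc hd'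
    by_contra hn
    have hlt : d ⊂ d' := ⟨hsub, hn⟩
    obtain ⟨z, hz⟩ := F.nonempty_of_mem d hdF
    rcases lam' F hdF' hcF (hsub hz) (hdc.1 hz) with h1 | h1
    · exact hmax d' hdF' hlt h1
    · rcases h with h | h
      · exact ha' (h1 h.1)
      · exact hb' (h1 h.1)
  rcases lam F (E1_subset F a b hd) (E1_subset F a b hd') hy hy' with h | h
  · exact h.antisymm (main d d' hd hd' h)
  · exact (main d' d hd' hd h).antisymm h

theorem ord_cut_E1 (F : XForest X) {a b : X} {s : Finset X} (hs : s ∈ F.clusters)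
    (ha : a ∈ s) (hb : b ∈ s) (hcard : 2 ≤ (F.E1 a b).card) :
    F.ord + 2 ≤ (F.cut (F.E1 a b)).ord := by
  classical
  have hE := E1_subset F a b
  obtain ⟨d1, hd1, d2, hd2, hne⟩ := Finset.one_lt_card.1 hcard
  obtain ⟨y1, hy1⟩ := F.nonempty_of_mem _ (hE hd1)
  obtain ⟨y2, hy2⟩ := F.nonempty_of_mem _ (hE hd2)
  obtain ⟨C, hC, hsC⟩ := exists_comp F hs
  have hsub : ∀ d ∈ F.E1 a b, d ⊆ C := by
    intro d hd
    obtain ⟨c, ⟨hdF, hcF, hdc, hmax⟩, -, -, h⟩ := E1_desc hd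
    refine hdc.1.trans ?_
    rcases h with h | h
    · exact sub_comp F hC hcF (hsC ha) h.1
    · exact sub_comp F hC hcF (hsC hb) h.1
  have hcomp : ∀ x : X, ∃ K ∈ (F.cut (F.E1 a b)).components, x ∈ K := by
    intro x
    obtain ⟨K, hK, h⟩ := exists_comp (F.cut (F.E1 a b)) ((F.cut _).singleton_mem x)
    exact ⟨K, hK, h (Finset.mem_singleton_self x)⟩
  -- a component meeting a hanging edge stays inside it
  have hin : ∀ d ∈ F.E1 a b, ∀ K ∈ (F.cut (F.E1 a b)).components, ∀ y ∈ d, y ∈ K → K ⊆ d := by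
    intro d hd K hK y hyd hyK
    obtain ⟨-, w, hw, rfl⟩ := (mem_cut hE).1 (mem_comp.1 hK).1
    obtain ⟨hyw, hy⟩ := mem_res.1 hyK
    rcases lam' F (hE hd) hw hyd hyw with h | h
    · exact absurd hyd (hy d hd h)
    · exact (res_subset _ _).trans h
  obtain ⟨K0, hK0, haK0⟩ := hcomp a
  obtain ⟨K1, hK1, hyK1⟩ := hcomp y1
  obtain ⟨K2, hK2, hyK2⟩ := hcomp y2
  have hK1d := hin d1 hd1 K1 hK1 y1 hy1 hyK1
  have hK2d := hin d2 hd2 K2 hK2 y2 hy2 hyK2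
  have ha1 : a ∉ d1 := by obtain ⟨c, -, h, -⟩ := E1_desc hd1; exact h
  have ha2 : a ∉ d2 := by obtain ⟨c, -, h, -⟩ := E1_desc hd2; exact h
  have h12 : K1 ≠ K2 := by
    rintro rfl
    exact hne (E1_disj hd1 hd2 (hK1d hyK1) (hK2d hyK1))
  have := ord_lower (F := F) (H := F.cut (F.E1 a b)) (R := {K1, K2}) (by
    intro K hK
    rcases Finset.mem_insert.1 hK with rfl | hK
    · exact hK1
    · rw [Finset.mem_singleton.1 hK]; exact hK2) (fun C' hC' => ?_)
  · rwa [Finset.card_pair h12] at this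
  · by_cases hCC : C' = C
    · subst hCC
      refine ⟨K0, hK0, ?_, comp_of_cut_sub hE (mem_comp.1 hK0).1 hC haK0 (hsC ha)⟩
      intro h
      rcases Finset.mem_insert.1 h with rfl | h
      · exact ha1 (hK1d haK0)
      · rw [Finset.mem_singleton] at h
        subst h
        exact ha2 (hK2d haK0)
    · obtain ⟨y, hy⟩ := F.nonempty_of_mem _ (mem_comp.1 hC').1
      obtain ⟨K, hK, hyK⟩ := hcomp y
      refine ⟨K, hK, ?_, comp_of_cut_sub hE (mem_comp.1 hK).1 hC' hyK hy⟩
      intro h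
      apply hCC
      rcases Finset.mem_insert.1 h with rfl | h
      · exact comp_unique F hC' hC hy (hsub d1 hd1 (hK1d hyK))
      · rw [Finset.mem_singleton] at h
        subst h
        exact comp_unique F hC' hC hy (hsub d2 hd2 (hK2d hyK))

/-- if `x` is isolated in `G`, then `G` is a subforest after removing `x`. -/
theorem sub_of_isolated {F G : XForest X} {x : X} (hG : XForest.IsSubforest G F)
    (hx : ({x} : Finset X) ∈ G.components) : XForest.IsSubforest G (F.cut {({x} : Finset X)}) := by
  classical
  obtain ⟨D, hD, hGe⟩ := hG
  have hE := sing_subset F x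
  have hU : D ∪ {({x} : Finset X)} ⊆ F.clusters := Finset.union_subset hD hE
  refine sub_cut_of_union (DE := D ∪ {{x}}) hD hE (fun d => by simp [or_comm]) ?_
  rw [hGe]
  have hiso : ∀ s ∈ F.clusters, x ∈ res D s → res D s = {x} := by
    intro s hs hxs
    have h1 : res D s ∈ G.clusters := by
      rw [hGe]; exact (mem_cut hD).2 ⟨⟨x, hxs⟩, s, hs, rfl⟩
    by_contra hne
    exact (mem_comp.1 hx).2 _ h1 (Finset.ssubset_iff_subset_ne.2
      ⟨Finset.singleton_subset_iff.2 hxs, fun h => hne h.symm⟩)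
  have hle : ∀ s, res (D ∪ {({x} : Finset X)}) s ⊆ res D s := by
    intro s y hy
    obtain ⟨h1, h2⟩ := mem_res.1 hy
    exact mem_res.2 ⟨h1, fun d hd => h2 d (Finset.mem_union_left _ hd)⟩
  have hge : ∀ s y, y ≠ x → y ∈ res D s → y ∈ res (D ∪ {({x} : Finset X)}) s := by
    intro s y hyx hy
    obtain ⟨h1, h2⟩ := mem_res.1 hy
    refine mem_res.2 ⟨h1, fun d hd hds => ?_⟩
    rcases Finset.mem_union.1 hd with h | h
    · exact h2 d h hds
    · rw [Finset.mem_singleton.1 h]; simpa using hyx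
  have hsame : ∀ s, x ∉ res D s → res D s = res (D ∪ {({x} : Finset X)}) s := by
    intro s hxs
    refine Finset.Subset.antisymm (fun y hy => hge s y ?_ hy) (hle s)
    rintro rfl; exact hxs hy
  ext t
  constructor
  · intro ht
    obtain ⟨hne, s, hs, rfl⟩ := (mem_cut hD).1 ht
    by_cases hxs : x ∈ res D s
    · rw [hiso s hs hxs]; exact (F.cut _).singleton_mem x
    · rw [hsame s hxs] at hne ⊢
      exact (mem_cut hU).2 ⟨hne, s, hs, rfl⟩
  · intro ht
    obtain ⟨hne, s, hs, rfl⟩ := (mem_cut hU).1 ht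
    by_cases hxs : x ∈ res D s
    · have h1 := hle s
      rw [hiso s hs hxs] at h1
      rw [(Finset.Nonempty.subset_singleton_iff hne).1 h1]
      exact (F.cut _).singleton_mem x
    · rw [← hsame s hxs] at hne ⊢
      exact (mem_cut hD).2 ⟨hne, s, hs, rfl⟩

/-- if `a` and `b` are adjacent siblings in `G` then the hanging edges of `E1` can be removed. -/
theorem sub_of_siblings {F G : XForest X} {a b : X} (hG : XForest.IsSubforest G F)
    (hab : ∃ t ∈ G.clusters, a ∈ t ∧ b ∈ t)
    (ha : ∀ t ∈ G.clusters, a ∈ t → b ∉ t → t = {a})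
    (hb : ∀ t ∈ G.clusters, b ∈ t → a ∉ t → t = {b}) :
    XForest.IsSubforest G (F.cut (F.E1 a b)) := by
  classical
  obtain ⟨D, hD, hGe⟩ := hG
  have hE := E1_subset F a b
  have hU : D ∪ F.E1 a b ⊆ F.clusters := Finset.union_subset hD hE
  refine sub_cut_of_union (DE := D ∪ F.E1 a b) hD hE (fun d => by simp) ?_
  rw [hGe]
  -- covering of the hanging edges
  have hpath : ∀ a b : X, (∃ t ∈ G.clusters, a ∈ t ∧ b ∈ t) →
      (∀ t ∈ G.clusters, a ∈ t → b ∉ t → t = {a}) →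
      ∀ d c, F.IsChild d c → a ∉ d → a ∈ c → b ∉ c → ∀ y ∈ d, ∃ e ∈ D, y ∈ e ∧ e ⊆ d := by
    intro a b hab ha d c ⟨hdF, hcF, hdc, hmax⟩ had hac hbc y hy
    obtain ⟨t, ht, hat, hbt⟩ := hab
    rw [hGe] at ht
    obtain ⟨-, s, hs, rfl⟩ := (mem_cut hD).1 ht
    have hcs : c ⊂ s := by
      rcases lam F hcF hs hac (res_subset _ _ hat) with h | h
      · exact ⟨h, fun h' => hbc (h' (res_subset _ _ hbt))⟩
      · exact absurd (h (res_subset _ _ hbt)) hbc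
    have hac' : a ∈ res D c := mem_res.2 ⟨hac, fun e he hec =>
      (mem_res.1 hat).2 e he (hec.trans hcs)⟩
    have hcG : res D c ∈ G.clusters := by
      rw [hGe]; exact (mem_cut hD).2 ⟨⟨a, hac'⟩, c, hcF, rfl⟩
    have heq := ha _ hcG hac' (fun h => hbc (res_subset _ _ h))
    have hyn : y ∉ res D c := by
      rw [heq, Finset.mem_singleton]; rintro rfl; exact had hy
    rw [mem_res] at hyn
    push Not at hyn
    obtain ⟨e, he, hec, hye⟩ := hyn (hdc.1 hy)
    refine ⟨e, he, hye, ?_⟩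
    rcases lam' F hdF (hD he) hy hye with h | h
    · exact absurd hec (hmax e (hD he) h)
    · exact h
  have hcov : ∀ d ∈ F.E1 a b, ∀ y ∈ d, ∃ e ∈ D, y ∈ e ∧ e ⊆ d := by
    intro d hd y hy
    obtain ⟨c, hch, had, hbd, h | h⟩ := E1_desc hd
    · exact hpath a b hab ha d c hch had h.1 h.2 y hy
    · refine hpath b a ?_ hb d c hch hbd h.1 h.2 y hy
      obtain ⟨t, h1, h2, h3⟩ := hab
      exact ⟨t, h1, h3, h2⟩
  have hres : ∀ s, res D s = res (D ∪ F.E1 a b) s := by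
    intro s
    ext y
    rw [mem_res, mem_res]
    refine and_congr_right fun hys => ⟨fun h d hd hds hyd => ?_, fun h d hd =>
      h d (Finset.mem_union_left _ hd)⟩
    rcases Finset.mem_union.1 hd with hd | hd
    · exact h d hd hds hyd
    · obtain ⟨e, he, hye, hed⟩ := hcov d hd y hyd
      exact h e he (lt_of_le_of_lt hed hds) hye
  ext t
  rw [mem_cut hD, mem_cut hU]
  simp only [hres]

/-- in an MSS, a cluster containing `x` is `{x}` or contains the MSS. -/
theorem mss_cluster {F : XForest X} {S : Finset X} (h : F.IsMSS S) {x : X} (hx : x ∈ S)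
    {s : Finset X} (hs : s ∈ F.clusters) (hxs : x ∈ s) : s = {x} ∨ S ⊆ s := by
  obtain ⟨hS, -, hc⟩ := h
  rcases lam' F hs hS hxs hx with h1 | h1
  · left
    obtain ⟨y, rfl⟩ := Finset.card_eq_one.1 (hc s hs h1)
    rw [Finset.mem_singleton.1 hxs]
  · exact Or.inr h1

/-- the labels of an MSS that are not isolated in a subforest stay siblings. -/
theorem mss_sub {F G : XForest X} {S : Finset X} (h : F.IsMSS S)
    (hG : XForest.IsSubforest G F) {a b : X} (ha : a ∈ S) (hb : b ∈ S) 
    (hna : ({a} : Finset X) ∉ G.components) (hnb : ({b} : Finset X) ∉ G.components) :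
    (∃ t ∈ G.clusters, a ∈ t ∧ b ∈ t) ∧ (∀ t ∈ G.clusters, a ∈ t → b ∉ t → t = {a}) := by
  obtain ⟨D, hD, hGe⟩ := hG
  have hex : ∀ a : X, a ∈ S → ({a} : Finset X) ∉ G.components →
      ∃ s ∈ F.clusters, S ⊆ s ∧ a ∈ res D s ∧ {a} ∉ D := by
    intro a ha hna
    rw [mem_comp] at hna
    push Not at hna
    obtain ⟨t, ht, hat⟩ := hna (G.singleton_mem a)
    rw [hGe] at ht
    obtain ⟨-, s, hs, rfl⟩ := (mem_cut hD).1 ht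
    have hlt : ({a} : Finset X) ⊂ s := lt_of_lt_of_le hat (res_subset _ _)
    have has : a ∈ res D s := hat.1 (Finset.mem_singleton_self a)
    refine ⟨s, hs, ?_, has, fun hmem => (mem_res.1 has).2 _ hmem hlt (by simp)⟩
    rcases mss_cluster h ha hs (res_subset _ _ has) with h1 | h1
    · exact absurd h1.symm hlt.ne
    · exact h1
  obtain ⟨s, hs, hSs, has, haD⟩ := hex a ha hna
  obtain ⟨s', hs', hSs', hbs', hbD⟩ := hex b hb hnb
  have key : ∀ w ∈ F.clusters, S ⊆ w → a ∈ res D w → b ∈ res D w := by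
    intro w hw hSw haw
    refine mem_res.2 ⟨hSw hb, fun d hd hdw hbd => ?_⟩
    rcases mss_cluster h hb (hD hd) hbd with h1 | h1
    · exact hbD (h1 ▸ hd)
    · exact (mem_res.1 haw).2 d hd hdw (h1 ha)
  refine ⟨⟨res D s, ?_, has, key s hs hSs has⟩, ?_⟩
  · rw [hGe]; exact (mem_cut hD).2 ⟨⟨a, has⟩, s, hs, rfl⟩
  · intro t ht hat hbt
    rw [hGe] at ht
    obtain ⟨-, w, hw, rfl⟩ := (mem_cut hD).1 ht
    rcases mss_cluster h ha hw (res_subset _ _ hat) with h1 | h1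
    · refine Finset.Subset.antisymm ?_ (Finset.singleton_subset_iff.2 hat)
      exact (res_subset _ _).trans h1.subset
    · exact absurd (key w hw h1 hat) hbt

theorem ordMax_eq {m : ℕ} (I : Inst X m) (hm : 0 < m) {n : ℕ} (h : ∀ i, (I.F i).ord = n) :
    I.ordMax = n := by
  unfold Inst.ordMax
  refine le_antisymm (Finset.sup_le fun i _ => (h i).le) ?_
  rw [← h ⟨0, hm⟩]
  exact Finset.le_sup (f := fun i => (I.F i).ord) (Finset.mem_univ _)

theorem E1_mss {F : XForest X} {S : Finset X} (h : F.IsMSS S) {a b : X} (ha : a ∈ S)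
    (hb : b ∈ S) : F.E1 a b = ∅ := by
  rw [Finset.eq_empty_iff_forall_notMem]
  intro d hd
  obtain ⟨c, ⟨hdF, hcF, hdc, hmax⟩, had, hbd, h2⟩ := E1_desc hd
  obtain ⟨z, hz⟩ := F.nonempty_of_mem d hdF
  rcases h2 with h2 | h2
  · rcases mss_cluster h ha hcF h2.1 with h1 | h1
    · have := hdc.1 hz
      rw [h1, Finset.mem_singleton] at this
      exact had (this ▸ hz)
    · exact h2.2 (h1 hb)
  · rcases mss_cluster h hb hcF h2.1 with h1 | h1
    · have := hdc.1 hz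
      rw [h1, Finset.mem_singleton] at this
      exact hbd (this ▸ hz)
    · exact h2.2 (h1 ha)

end

end HelperMAF

/-- Lemma 4.8, Branching Rule 3.2.  Let `(F_1, …, F_m; k)`
satisfy the label-set isomorphism property with `S` a minimum MSS lying in
`F_1`, `|S| ≥ 3`, and suppose there are a forest `F_p` and labels
`x₁, x₂ ∈ S` with `|E^1_{F_p}(x₁,x₂)| ≥ 2` (Case 3.2).  Then Branching Rule
3.2 — [1] remove the edge incident to `x₁` in all forests; [2] remove the edge
incident to `x₂` in all forests; [3] remove the edges of `E^1_{F_i}(x₁,x₂)` in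
every `F_i`, `2 ≤ i ≤ m` — is safe and satisfies the recurrence relation
`T(k) ≤ 2·T(k-1) + T(k-2)`. -/
theorem statement_14 {X : Type*} [DecidableEq X] [Fintype X] {m : ℕ} (hm : 0 < m)
    (I I₁ I₂ I₃ : Inst X m) (S : Finset X) (hS3 : 3 ≤ S.card)
    (hiso : InstLabelIso I)
    (hMSS : I.MinMSS ⟨0, hm⟩ S)
    (x₁ x₂ : X) (hx₁ : x₁ ∈ S) (hx₂ : x₂ ∈ S) (hx12 : x₁ ≠ x₂)
    (p : Fin m) (hcase : 2 ≤ ((I.F p).E1 x₁ x₂).card)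
    (hI₁F : I₁.F = fun i => (I.F i).cut {({x₁} : Finset X)}) (hI₁k : I₁.k = I.k - 1)
    (hI₂F : I₂.F = fun i => (I.F i).cut {({x₂} : Finset X)}) (hI₂k : I₂.k = I.k - 1)
    (hI₃F : I₃.F = fun i =>
      if i = ⟨0, hm⟩ then I.F i else (I.F i).cut ((I.F i).E1 x₁ x₂))
    (hI₃k : I₃.k = I.k + I.ordMax - I₃.ordMax) :
    (I.IsYes ↔ I₁.IsYes ∨ I₂.IsYes ∨ I₃.IsYes) ∧
    I₃.k ≤ I.k - 2 ∧
    RecBound I.k [I₁.k, I₂.k, I₃.k] 2 1 := by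
  classical
  have hMS := hMSS.1
  -- all orders agree
  have hord : ∀ i, (I.F i).ord = (I.F ⟨0, hm⟩).ord := fun i => by
    unfold XForest.ord; rw [hiso i ⟨0, hm⟩]
  have hmax := HelperMAF.ordMax_eq I hm hord
  obtain ⟨C, hC, hSC⟩ := HelperMAF.exists_comp (I.F ⟨0, hm⟩) hMS.1
  have hCi : ∀ i, C ∈ (I.F i).clusters := fun i => by
    have h : C ∈ (I.F i).components := by rw [hiso i ⟨0, hm⟩]; exact hC
    exact (HelperMAF.mem_comp.1 h).1
  have hlt : ∀ x ∈ S, ({x} : Finset X) ⊂ C := by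
    intro x hx
    refine Finset.ssubset_iff_subset_ne.2 ⟨Finset.singleton_subset_iff.2 (hSC hx), fun h => ?_⟩
    have := Finset.card_le_card hSC
    rw [← h, Finset.card_singleton] at this
    omega
  have hcutmax : ∀ (J : Inst X m) (x : X), x ∈ S →
      J.F = (fun i => (I.F i).cut {({x} : Finset X)}) → J.ordMax = I.ordMax + 1 := by
    intro J x hx hJ
    refine HelperMAF.ordMax_eq J hm fun i => ?_
    rw [hJ, hmax, ← hord i]
    exact HelperMAF.ord_cut_single (I.F i) (hCi i) (hlt x hx)
  have hm1 := hcutmax I₁ x₁ hx₁ hI₁F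
  have hm2 := hcutmax I₂ x₂ hx₂ hI₂F
  have hp0 : p ≠ ⟨0, hm⟩ := by
    rintro rfl
    rw [HelperMAF.E1_mss hMS hx₁ hx₂] at hcase
    simp at hcase
  have hm3 : I.ordMax + 2 ≤ I₃.ordMax := by
    have h1 := HelperMAF.ord_cut_E1 (I.F p) (hCi p) (hSC hx₁) (hSC hx₂) hcase
    have h2 : (I₃.F p).ord ≤ I₃.ordMax :=
      Finset.le_sup (f := fun i => (I₃.F i).ord) (Finset.mem_univ p)
    have h3 : I₃.F p = (I.F p).cut ((I.F p).E1 x₁ x₂) := by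
      rw [hI₃F]; simp only [if_neg hp0]
    rw [h3] at h2
    rw [hmax, ← hord p]
    omega
  have hk3 : I₃.k ≤ I.k - 2 := by omega
  refine ⟨⟨?_, ?_⟩, hk3, ?_⟩
  · rintro ⟨G, hG, hGo⟩
    by_cases h1 : ({x₁} : Finset X) ∈ G.components
    · left
      refine ⟨G, fun i => ?_, by rw [hm1, hI₁k]; push_cast; linarith⟩
      rw [hI₁F]
      exact HelperMAF.sub_of_isolated (hG i) h1
    by_cases h2 : ({x₂} : Finset X) ∈ G.components
    · right; left
      refine ⟨G, fun i => ?_, by rw [hm2, hI₂k]; push_cast; linarith⟩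
      rw [hI₂F]
      exact HelperMAF.sub_of_isolated (hG i) h2
    right; right
    refine ⟨G, fun i => ?_, by rw [hI₃k]; linarith⟩
    rw [hI₃F]
    by_cases hi : i = ⟨0, hm⟩
    · simp only [if_pos hi]
      exact hG i
    · simp only [if_neg hi]
      obtain ⟨ha, hb⟩ := HelperMAF.mss_sub hMS (hG _) hx₁ hx₂ h1 h2
      obtain ⟨-, hb'⟩ := HelperMAF.mss_sub hMS (hG _) hx₂ hx₁ h2 h1
      exact HelperMAF.sub_of_siblings (hG i) ha hb hb'
  · rintro (⟨G, hG, hGo⟩ | ⟨G, hG, hGo⟩ | ⟨G, hG, hGo⟩)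
    · refine ⟨G, fun i => ?_, by rw [hm1, hI₁k] at hGo; push_cast at hGo; linarith⟩
      have := hG i
      rw [hI₁F] at this
      exact HelperMAF.sub_trans_cut (HelperMAF.sing_subset _ _) this
    · refine ⟨G, fun i => ?_, by rw [hm2, hI₂k] at hGo; push_cast at hGo; linarith⟩
      have := hG i
      rw [hI₂F] at this
      exact HelperMAF.sub_trans_cut (HelperMAF.sing_subset _ _) this
    · refine ⟨G, fun i => ?_, by rw [hI₃k] at hGo; linarith⟩
      have := hG i
      rw [hI₃F] at this
      by_cases hi : i = ⟨0, hm⟩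
      · simp only [if_pos hi] at this
        exact this
      · simp only [if_neg hi] at this
        exact HelperMAF.sub_trans_cut (HelperMAF.E1_subset _ _ _) this
  · intro T hT0 hTm hT
    have h1 := hT I.k
    have h2 := hTm hk3
    simp only [List.map_cons, List.map_nil, List.sum_cons, List.sum_nil, hI₁k, hI₂k]
    push_cast at h1
    linarith
end

section
/- Let S ⊆ X with |S| ≥ 3 and let F be an X-forest in which all labels of S lie in one connected component. If S is not a maximal sibling-set in F and |E^1_F(x,x')| ≤ 1 for every two labels x, x' ∈ S, then the minimal subtree T_F[L(lca_F(S))] induced by L(lca_F(S)) has one of the following three forms: (1) every label of S is a child of lca_F(S); (2) exactly one label x_1 ∈ S is not a child of lca_F(S), its parent p has degree exactly 3, p is a child of lca_F(S), and all labels of S∖{x_1} are children of lca_F(S); (3) exactly two labels x_1, x_2 ∈ S are not children of lca_F(S); they share a common parent p of degree exactly 3 that is a child of lca_F(S), and all labels of S∖{x_1,x_2} are children of lca_F(S). -/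
/-!
A formalization framework for the Maximum Agreement Forest problem on multiple
rooted multifurcating phylogenetic trees.

An `X`-forest is modeled (up to forced contraction and label-preserving
isomorphism) by the laminar family of the label-sets `L(v)` of its vertices:
every vertex `v` is identified with the set `L(v)` of labels at its leaf
descendants, components correspond to the maximal clusters, leaves to the
singleton clusters, and the edge between a non-root vertex `v` and its parent
is identified with the cluster `L(v)`.
-/

open Finset

namespace XForest

theorem child_above {X : Type*} [DecidableEq X] [Fintype X] (F : XForest X)
    {s p : Finset X} (hs : s ∈ F.clusters) (hp : p ∈ F.clusters) (h : s ⊂ p) :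
    ∃ d, F.IsChild d p ∧ s ⊆ d := by
  classical
  obtain ⟨m, hm, hmax⟩ := Finset.exists_max_image
    (F.clusters.filter fun t => s ⊆ t ∧ t ⊂ p) Finset.card
    ⟨s, Finset.mem_filter.mpr ⟨hs, Finset.Subset.refl _, h⟩⟩
  rw [Finset.mem_filter] at hm
  refine ⟨m, ⟨hm.1, hp, hm.2.2, ?_⟩, hm.2.1⟩
  intro t ht hmt htp
  have h1 := hmax t (Finset.mem_filter.mpr ⟨ht, hm.2.1.trans hmt.1, htp⟩)
  have h2 := Finset.card_lt_card hmt
  omega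

theorem child_at {X : Type*} [DecidableEq X] [Fintype X] (F : XForest X)
    {x : X} {p : Finset X} (hp : p ∈ F.clusters) (hx : x ∈ p) (hne : p ≠ {x}) :
    ∃ d, F.IsChild d p ∧ x ∈ d := by
  obtain ⟨d, hd, h⟩ := F.child_above (F.singleton_mem x) hp
    (Finset.ssubset_iff_subset_ne.mpr ⟨Finset.singleton_subset_iff.mpr hx, hne.symm⟩)
  exact ⟨d, hd, Finset.singleton_subset_iff.mp h⟩

theorem child_unique {X : Type*} [DecidableEq X] [Fintype X] (F : XForest X)
    {x : X} {p d e : Finset X} (hd : F.IsChild d p) (he : F.IsChild e p)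
    (hxd : x ∈ d) (hxe : x ∈ e) : d = e := by
  by_contra hne
  rcases F.laminar d hd.1 e he.1 (Finset.not_disjoint_iff.mpr ⟨x, hxd, hxe⟩) with h | h
  · exact hd.2.2.2 e he.1 (Finset.ssubset_iff_subset_ne.mpr ⟨h, hne⟩) he.2.2.1
  · exact he.2.2.2 d hd.1 (Finset.ssubset_iff_subset_ne.mpr ⟨h, Ne.symm hne⟩) hd.2.2.1

theorem child_avoid {X : Type*} [DecidableEq X] [Fintype X] (F : XForest X)
    {x : X} {p : Finset X} (hp : p ∈ F.clusters) (hx : x ∈ p) (hne : p ≠ {x}) :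
    ∃ d, F.IsChild d p ∧ x ∉ d := by
  obtain ⟨e, he, hxe⟩ := F.child_at hp hx hne
  obtain ⟨z, hzp, hze⟩ := Finset.exists_of_ssubset he.2.2.1
  have hpz : p ≠ {z} := by
    rintro rfl
    rw [Finset.mem_singleton] at hx
    exact hze (hx ▸ hxe)
  obtain ⟨d, hd, hzd⟩ := F.child_at hp hzp hpz
  refine ⟨d, hd, fun hxd => hze ?_⟩
  rw [← F.child_unique hd he hxd hxe]
  exact hzd

theorem lca2_eq {X : Type*} [DecidableEq X] [Fintype X] (F : XForest X)
    {x y : X} {p L : Finset X} (hp : F.IsChild p L) (hx : x ∈ p) (hy : y ∉ p) (hyL : y ∈ L) :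
    F.lca2 x y = L := by
  unfold lca2
  apply le_antisymm
  · exact Finset.inf_le (f := id)
      (Finset.mem_filter.mpr ⟨hp.2.1, hp.2.2.1.1 hx, hyL⟩)
  · apply Finset.le_inf
    intro s hs
    obtain ⟨hs, hxs, hys⟩ := Finset.mem_filter.mp hs
    rcases F.laminar L hp.2.1 s hs (Finset.not_disjoint_iff.mpr ⟨y, hyL, hys⟩) with h | h
    · exact h
    · by_cases hE : s = L
      · exact hE.symm.le
      · exfalso
        rcases F.laminar p hp.1 s hs (Finset.not_disjoint_iff.mpr ⟨x, hx, hxs⟩) with h' | h'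
        · refine hp.2.2.2 s hs (Finset.ssubset_iff_subset_ne.mpr ⟨h', ?_⟩)
            (Finset.ssubset_iff_subset_ne.mpr ⟨h, hE⟩)
          rintro rfl
          exact hy hys
        · exact hy (h' hys)

theorem lcaS_spec {X : Type*} [DecidableEq X] [Fintype X] (F : XForest X)
    {S : Finset X} (hS : S.Nonempty) (hconn : ∃ C ∈ F.components, S ⊆ C) :
    F.lcaS S ∈ F.clusters ∧ S ⊆ F.lcaS S ∧ ∀ s ∈ F.clusters, S ⊆ s → F.lcaS S ⊆ s := by
  classical
  obtain ⟨C, hC, hSC⟩ := hconn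
  have hle : ∀ s ∈ F.clusters, S ⊆ s → F.lcaS S ⊆ s := fun s hs hSs =>
    Finset.inf_le (f := id) (Finset.mem_filter.mpr ⟨hs, hSs⟩)
  obtain ⟨m, hm, hmin⟩ := Finset.exists_min_image
    (F.clusters.filter fun t => S ⊆ t) Finset.card
    ⟨C, Finset.mem_filter.mpr ⟨(Finset.mem_filter.mp hC).1, hSC⟩⟩
  have hm' := Finset.mem_filter.mp hm
  have hEq : F.lcaS S = m := by
    apply le_antisymm (hle m hm'.1 hm'.2)
    apply Finset.le_inf
    intro s hs
    have hs' := Finset.mem_filter.mp hs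
    obtain ⟨x, hx⟩ := hS
    rcases F.laminar m hm'.1 s hs'.1
      (Finset.not_disjoint_iff.mpr ⟨x, hm'.2 hx, hs'.2 hx⟩) with h | h
    · exact h
    · exact (Finset.eq_of_subset_of_card_le h
        (hmin s (Finset.mem_filter.mpr ⟨hs'.1, hs'.2⟩))).symm.le
  exact ⟨hEq ▸ hm'.1, hEq ▸ hm'.2, hle⟩

theorem mem_E1_left {X : Type*} [DecidableEq X] [Fintype X] (F : XForest X)
    {x y : X} {c d : Finset X} (hd : F.IsChild d c) (hc : c ⊂ F.lca2 x y)
    (hxc : x ∈ c) (hxd : x ∉ d) : d ∈ F.E1 x y := by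
  classical
  unfold E1
  refine Finset.mem_filter.mpr ⟨hd.1, c, hd.2.1, hd, hc, Or.inl ⟨hxc, ?_, hxd⟩⟩
  rintro rfl
  obtain ⟨z, hz⟩ := F.nonempty_of_mem d hd.1
  have := Finset.mem_singleton.mp (hd.2.2.1.1 hz)
  exact hxd (this ▸ hz)

theorem mem_E1_right {X : Type*} [DecidableEq X] [Fintype X] (F : XForest X)
    {x y : X} {c d : Finset X} (hd : F.IsChild d c) (hc : c ⊂ F.lca2 x y)
    (hyc : y ∈ c) (hyd : y ∉ d) : d ∈ F.E1 x y := by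
  classical
  unfold E1
  refine Finset.mem_filter.mpr ⟨hd.1, c, hd.2.1, hd, hc, Or.inr ⟨hyc, ?_, hyd⟩⟩
  rintro rfl
  obtain ⟨z, hz⟩ := F.nonempty_of_mem d hd.1
  have := Finset.mem_singleton.mp (hd.2.2.1.1 hz)
  exact hyd (this ▸ hz)

/-- The structure forced by a pair of labels whose lca is `L`. -/
theorem pair_structure {X : Type*} [DecidableEq X] [Fintype X] (F : XForest X)
    {x y : X} {p L : Finset X} (hp : F.IsChild p L) (hx : x ∈ p) (hy : y ∉ p) (hyL : y ∈ L)
    (hpx : p ≠ {x}) (hE : (F.E1 x y).card ≤ 1) :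
    F.IsChild {x} p ∧
    (∃ v, F.IsChild v p ∧ v ≠ {x} ∧ ∀ c, F.IsChild c p → c = {x} ∨ c = v) ∧
    F.IsChild {y} L := by
  have hl := F.lca2_eq hp hx hy hyL
  have huniq : ∀ a ∈ F.E1 x y, ∀ b ∈ F.E1 x y, a = b := fun a ha b hb =>
    Finset.card_le_one.mp hE a ha b hb
  have hpl : p ⊂ F.lca2 x y := hl ▸ hp.2.2.1
  obtain ⟨v, hv, hxv⟩ := F.child_avoid hp.1 hx hpx
  have hvE := F.mem_E1_left hv hpl hx hxv
  obtain ⟨e, he, hxe⟩ := F.child_at hp.1 hx hpx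
  have hex : e = {x} := by
    by_contra hne
    obtain ⟨d, hd, hxd⟩ := F.child_avoid he.1 hxe hne
    have hdE := F.mem_E1_left hd (he.2.2.1.trans hpl) hxe hxd
    have hdv := huniq d hdE v hvE
    subst hdv
    exact hv.2.2.2 e he.1 hd.2.2.1 he.2.2.1
  subst hex
  refine ⟨he, ⟨v, hv, ?_, ?_⟩, ?_⟩
  · rintro rfl
    exact hxv (Finset.mem_singleton_self x)
  · intro c hc
    by_cases hxc : x ∈ c
    · exact Or.inl (F.child_unique hc he hxc hxe)
    · exact Or.inr (huniq c (F.mem_E1_left hc hpl hx hxc) v hvE)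
  · have hLy : L ≠ {y} := by
      rintro rfl
      exact hy ((Finset.mem_singleton.mp (hp.2.2.1.1 hx)) ▸ hx)
    obtain ⟨q, hq, hyq⟩ := F.child_at hp.2.1 hyL hLy
    by_cases hqy : q = {y}
    · exact hqy ▸ hq
    · exfalso
      obtain ⟨d, hd, hyd⟩ := F.child_avoid hq.1 hyq hqy
      have hdv := huniq d (F.mem_E1_right hd (hl ▸ hq.2.2.1) hyq hyd) v hvE
      subst hdv
      obtain ⟨z, hz⟩ := F.nonempty_of_mem d hd.1
      have hpq := F.child_unique hp hq (hv.2.2.1.1 hz) (hd.2.2.1.1 hz)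
      exact hy (hpq ▸ hyq)

end XForest

/-- Lemma 4.9.  Let `S ⊆ X` with `|S| ≥ 3` and let `F` be an
`X`-forest in which all labels of `S` lie in one connected component.  If `S`
is not an MSS in `F` and `|E^1_F(x,x')| ≤ 1` for every two labels
`x, x' ∈ S`, then the minimal subtree induced by `L(lca_F(S))` has one of the
following three forms: (1) every label of `S` is a child of `lca_F(S)`;
(2) exactly one label `x₁ ∈ S` is not a child of `lca_F(S)`, its parent `p`
has degree exactly 3 and is a child of `lca_F(S)`, and all labels of
`S ∖ {x₁}` are children of `lca_F(S)`; (3) exactly two labels `x₁, x₂ ∈ S` are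
not children of `lca_F(S)`; they share a common parent `p` of degree exactly 3
that is a child of `lca_F(S)`, and all labels of `S ∖ {x₁,x₂}` are children of
`lca_F(S)`. -/
theorem statement_15 {X : Type*} [DecidableEq X] [Fintype X]
    (F : XForest X) (S : Finset X) (hS : 3 ≤ S.card)
    (hconn : ∃ C ∈ F.components, S ⊆ C)
    (hnot : ¬F.IsMSS S)
    (hE1 : ∀ x ∈ S, ∀ x' ∈ S, (F.E1 x x').card ≤ 1) :
    (∀ x ∈ S, F.IsChild {x} (F.lcaS S)) ∨
    (∃ x₁ ∈ S, ∃ p ∈ F.clusters, p ≠ F.lcaS S ∧ F.IsChild p (F.lcaS S) ∧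
      F.IsChild {x₁} p ∧
      (∃ v, F.IsChild v p ∧ v ≠ {x₁} ∧ ∀ c, F.IsChild c p → c = {x₁} ∨ c = v) ∧
      ∀ x ∈ S.erase x₁, F.IsChild {x} (F.lcaS S)) ∨
    (∃ x₁ ∈ S, ∃ x₂ ∈ S, x₁ ≠ x₂ ∧ ∃ p ∈ F.clusters, p ≠ F.lcaS S ∧
      F.IsChild p (F.lcaS S) ∧ F.IsChild {x₁} p ∧ F.IsChild {x₂} p ∧
      (∀ c, F.IsChild c p → c = {x₁} ∨ c = {x₂}) ∧
      ∀ x ∈ S, x ≠ x₁ → x ≠ x₂ → F.IsChild {x} (F.lcaS S)) := by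
  have hSne : S.Nonempty := Finset.card_pos.mp (by omega)
  obtain ⟨hL, hSL, hmin⟩ := F.lcaS_spec hSne hconn
  by_cases hall : ∀ x ∈ S, F.IsChild {x} (F.lcaS S)
  · exact Or.inl hall
  right
  push Not at hall
  obtain ⟨x, hxS, hx⟩ := hall
  have hLx : ∀ z, F.lcaS S ≠ {z} := by
    intro z h
    have := Finset.card_le_card hSL
    rw [h, Finset.card_singleton] at this
    omega
  obtain ⟨p, hp, hxp⟩ := F.child_at hL (hSL hxS) (hLx x)
  have hpx : ∀ z, p ≠ {z} := by
    rintro z rfl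
    rw [Finset.mem_singleton] at hxp
    subst hxp
    exact hx hp
  have hy : ∃ y ∈ S, y ∉ p := by
    by_contra hcon
    push Not at hcon
    exact hp.2.2.1.2 (hmin p hp.1 hcon)
  obtain ⟨y, hyS, hyp⟩ := hy
  have hout : ∀ z ∈ S, z ∉ p → F.IsChild {z} (F.lcaS S) := fun z hz hzp =>
    (F.pair_structure hp hxp hzp (hSL hz) (hpx x) (hE1 x hxS z hz)).2.2
  obtain ⟨hxc, ⟨v, hv, hvx, hvu⟩, -⟩ :=
    F.pair_structure hp hxp hyp (hSL hyS) (hpx x) (hE1 x hxS y hyS)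
  have hin : ∀ z ∈ S, z ∈ p → z = x ∨ v = {z} := by
    intro z hz hzp
    have hzc := (F.pair_structure hp hzp hyp (hSL hyS) (hpx z) (hE1 z hz y hyS)).1
    rcases hvu _ hzc with h | h
    · exact Or.inl (Finset.singleton_injective h)
    · exact Or.inr h.symm
  have hpL : p ≠ F.lcaS S := hp.2.2.1.ne
  by_cases hz : ∃ z ∈ S, z ∈ p ∧ z ≠ x
  · right
    obtain ⟨z, hzS, hzp, hzx⟩ := hz
    have hvz : v = {z} := (hin z hzS hzp).resolve_left hzx
    subst hvz
    refine ⟨x, hxS, z, hzS, hzx.symm, p, hp.1, hpL, hp, hxc, hv, hvu, ?_⟩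
    intro w hw hwx hwz
    refine hout w hw fun hwp => ?_
    rcases hin w hw hwp with h | h
    · exact hwx h
    · exact hwz (Finset.singleton_injective h).symm
  · left
    push Not at hz
    refine ⟨x, hxS, p, hp.1, hpL, hp, hxc, ⟨v, hv, hvx, hvu⟩, ?_⟩
    intro w hw
    obtain ⟨hwx, hwS⟩ := Finset.mem_erase.mp hw
    exact hout w hwS fun hwp => hwx (hz w hwS hwp)
end

section
/- Let (F_1,…,F_m;k) be an instance of the hMaf problem satisfying the label-set isomorphism property, with S = {x_1,…,x_{|S|}} a minimum maximal sibling-set of the instance lying in F_1, |S| ≥ 3, such that |E^1_F(x,x')| ≤ 1 for every X-forest F in the instance and all x, x' ∈ S (Case 3.3). Let 𝒞_2 be the nonempty collection of X-forests F in the instance in which not all labels of S are children of lca_F(S); for F ∈ 𝒞_2, let v_F be the vertex sharing a parent with the unique grandchild-label x_1 of lca_F(S), and let e_F be the edge between v_F and its parent. Then Branching Rule 3.3 — branch into 1+|S| ways: [1] remove the edge e_F for each F ∈ 𝒞_2; [1+i] for each 1 ≤ i ≤ |S|, remove the edges incident to the labels of S∖{x_i} in all X-forests — is safe, and it satisfies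 the recurrence relation T(k) ≤ 2T(k−1) + T(k−2). -/
/-!
A formalization framework for the Maximum Agreement Forest problem on multiple
rooted multifurcating phylogenetic trees.

An `X`-forest is modeled (up to forced contraction and label-preserving
isomorphism) by the laminar family of the label-sets `L(v)` of its vertices:
every vertex `v` is identified with the set `L(v)` of labels at its leaf
descendants, components correspond to the maximal clusters, leaves to the
singleton clusters, and the edge between a non-root vertex `v` and its parent
is identified with the cluster `L(v)`.
-/

open Finset

namespace BR33

section
open scoped Classical

variable {X : Type*} [DecidableEq X] [Fintype X]

/-- the remainder of the cluster `s` after the edges in `E` are removed. -/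
noncomputable def rest (F : XForest X) (E : Finset (Finset X)) (s : Finset X) : Finset X :=
  s.filter fun y => ∀ d ∈ E, d ∈ F.clusters → y ∈ d → s ⊆ d

theorem mem_rest {F : XForest X} {E : Finset (Finset X)} {s : Finset X} {y : X} :
    y ∈ rest F E s ↔ y ∈ s ∧ ∀ d ∈ E, d ∈ F.clusters → y ∈ d → s ⊆ d := by
  simp [rest]

theorem lam {F : XForest X} {s t : Finset X} (hs : s ∈ F.clusters) (ht : t ∈ F.clusters)
    {y : X} (h1 : y ∈ s) (h2 : y ∈ t) : s ⊆ t ∨ t ⊆ s :=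
  F.laminar s hs t ht (Finset.not_disjoint_iff.mpr ⟨y, h1, h2⟩)

theorem mem_cut {F : XForest X} {E : Finset (Finset X)} {t : Finset X} :
    t ∈ (F.cut E).clusters ↔ ∃ s ∈ F.clusters, rest F E s = t ∧ t.Nonempty := by
  have key : ∀ s ∈ F.clusters,
      (s \ ((E.filter fun d => d ∈ F.clusters).filter fun d => d ⊂ s).biUnion id) =
        rest F E s := by
    intro s hs
    ext y
    rw [mem_rest, Finset.mem_sdiff]
    refine and_congr_right fun hy => ?_
    rw [Finset.mem_biUnion]
    constructor
    · intro h d hd hdF hyd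
      rcases lam hs hdF hy hyd with h1 | h1
      · exact h1
      · by_contra hc
        exact h ⟨d, by simp only [Finset.mem_filter]; exact ⟨⟨hd, hdF⟩, h1, hc⟩, hyd⟩
    · rintro h ⟨d, hd, hyd⟩
      simp only [Finset.mem_filter] at hd
      exact hd.2.2 (h d hd.1.1 hd.1.2 hyd)
  unfold XForest.cut XForest.cutFam
  simp only [Finset.mem_filter, Finset.mem_image]
  constructor
  · rintro ⟨⟨s, hs, rfl⟩, hne⟩
    exact ⟨s, hs, (key s hs).symm, hne⟩
  · rintro ⟨s, hs, rfl, hne⟩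
    exact ⟨⟨s, hs, key s hs⟩, hne⟩

theorem rest_mono {F : XForest X} {E : Finset (Finset X)} {u w : Finset X}
    (hu : u ∈ F.clusters) (huw : u ⊆ w) {z : X} (hz : z ∈ rest F E u)
    (hzw : z ∈ rest F E w) : rest F E u ⊆ rest F E w := by
  intro y hy
  rw [mem_rest] at *
  refine ⟨huw hy.1, fun d hd hdF hyd => hzw.2 d hd hdF ?_⟩
  exact hy.2 d hd hdF hyd hz.1

/-- a minimal cluster with the same remainder. -/
theorem exists_min {F : XForest X} (E : Finset (Finset X)) {s : Finset X}
    (hs : s ∈ F.clusters) :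
    ∃ t ∈ F.clusters, rest F E t = rest F E s ∧
      ∀ u ∈ F.clusters, u ⊂ t → rest F E u ≠ rest F E s := by
  obtain ⟨t, ht, hmin⟩ := (F.clusters.filter fun t => rest F E t = rest F E s).exists_min_image
    Finset.card ⟨s, by simp [hs]⟩
  rw [Finset.mem_filter] at ht
  refine ⟨t, ht.1, ht.2, fun u hu hut he => ?_⟩
  have := hmin u (by simp [hu, he])
  have := Finset.card_lt_card hut
  omega

/-- cutting in two steps. -/
theorem cut_cut (F : XForest X) (E D D' : Finset (Finset X))
    (hD' : ∀ c, c ∈ D' ∧ c ∈ (F.cut E).clusters ↔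
      ∃ d ∈ D, d ∈ F.clusters ∧ rest F E d = c ∧ c.Nonempty) :
    ((F.cut E).cut D').clusters = (F.cut (D ∪ E)).clusters := by
  have hsplit : ∀ s y, y ∈ rest F (D ∪ E) s ↔
      y ∈ rest F E s ∧ ∀ d ∈ D, d ∈ F.clusters → y ∈ d → s ⊆ d := by
    intro s y
    simp only [mem_rest, Finset.mem_union]
    constructor
    · rintro ⟨h1, h2⟩
      exact ⟨⟨h1, fun d hd => h2 d (Or.inr hd)⟩, fun d hd => h2 d (Or.inl hd)⟩
    · rintro ⟨⟨h1, h2⟩, h3⟩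
      exact ⟨h1, fun d hd => hd.elim (h3 d) (h2 d)⟩
  have hD2 : ∀ s y, y ∈ rest (F.cut E) D' (rest F E s) ↔
      y ∈ rest F E s ∧ ∀ d ∈ D, d ∈ F.clusters → y ∈ rest F E d →
        rest F E s ⊆ rest F E d := by
    intro s y
    rw [mem_rest]
    refine and_congr_right fun _ => ?_
    constructor
    · intro h d hd hdF hyd
      have := (hD' (rest F E d)).2 ⟨d, hd, hdF, rfl, ⟨y, hyd⟩⟩
      exact h _ this.1 this.2 hyd
    · intro h c hc hcF hyc
      obtain ⟨d, hd, hdF, rfl, -⟩ := (hD' c).1 ⟨hc, hcF⟩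
      exact h d hd hdF hyc
  have down : ∀ {s d : Finset X} {y : X}, y ∈ rest F E s → y ∈ d → d ⊆ s →
      y ∈ rest F E d := by
    intro s d y hy hyd hds
    rw [mem_rest] at *
    exact ⟨hyd, fun e he heF hye => hds.trans (hy.2 e he heF hye)⟩
  have claim : ∀ s ∈ F.clusters, ∀ z, z ∈ rest F (D ∪ E) s →
      rest F (D ∪ E) s = rest (F.cut E) D' (rest F E s) := by
    intro s hs z hz
    ext y
    rw [hsplit, hD2]
    rw [hsplit] at hz
    refine and_congr_right fun hy => ?_
    constructor
    · intro h d hd hdF hyd w hw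
      have hyd' := mem_rest.1 hyd
      have hsd := h d hd hdF hyd'.1
      have hw' := mem_rest.1 hw
      refine mem_rest.2 ⟨hsd hw'.1, fun e he heF hwe => ?_⟩
      have hse := hw'.2 e he heF hwe
      exact hyd'.2 e he heF (hse (mem_rest.1 hy).1)
    · intro h d hd hdF hyd
      rcases lam hs hdF (mem_rest.1 hy).1 hyd with h1 | h1
      · exact h1
      · have := h d hd hdF (down hy hyd h1)
        exact hz.2 d hd hdF (mem_rest.1 (this hz.1)).1
  ext t
  rw [mem_cut, mem_cut]
  constructor
  · rintro ⟨s', hs', rfl, z, hz⟩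
    obtain ⟨s, hs, rfl, -⟩ := mem_cut.1 hs'
    obtain ⟨t, ht, hts, hmin⟩ := exists_min E hs
    have hz2 := (hD2 s z).1 hz
    have hzt : z ∈ rest F E t := hts ▸ hz2.1
    have hzz : z ∈ rest F (D ∪ E) t := by
      rw [hsplit]
      refine ⟨hzt, fun d hd hdF hzd => ?_⟩
      rcases lam ht hdF (mem_rest.1 hzt).1 hzd with h1 | h1
      · exact h1
      · by_contra hc
        have hzd' := down hzt hzd h1
        have h2 := hz2.2 d hd hdF hzd'
        have h3 := rest_mono hdF h1 hzd' hzt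
        exact hmin d hdF ⟨h1, hc⟩ (Finset.Subset.antisymm (hts ▸ h3) h2)
    exact ⟨t, ht, by rw [claim t ht z hzz, hts], ⟨z, hz⟩⟩
  · rintro ⟨s, hs, rfl, z, hz⟩
    exact ⟨rest F E s, mem_cut.2 ⟨s, hs, rfl, z, ((hsplit s z).1 hz).1⟩,
      (claim s hs z hz).symm, z, hz⟩

theorem cut_inter (F : XForest X) (E : Finset (Finset X)) :
    (F.cut E).clusters = (F.cut (E.filter fun d => d ∈ F.clusters)).clusters := by
  have : ∀ s, rest F E s = rest F (E.filter fun d => d ∈ F.clusters) s := by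
    intro s; ext y; rw [mem_rest, mem_rest]
    refine and_congr_right fun _ => ?_
    simp only [Finset.mem_filter]
    exact ⟨fun h d hd => h d hd.1, fun h d hd hdF => h d ⟨hd, hdF⟩ hdF⟩
  ext t; rw [mem_cut, mem_cut]; simp only [this]

theorem subforest_of_cut {F G : XForest X} {E : Finset (Finset X)}
    (h : XForest.IsSubforest G (F.cut E)) : XForest.IsSubforest G F := by
  obtain ⟨D', hD', hG⟩ := h
  refine ⟨((F.clusters.filter fun d => rest F E d ∈ D') ∪ E).filter
    fun d => d ∈ F.clusters, fun d hd => (Finset.mem_filter.1 hd).2, ?_⟩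
  rw [hG, ← cut_inter]
  apply cut_cut
  intro c
  constructor
  · rintro ⟨hc, hcF⟩
    obtain ⟨s, hs, rfl, hne⟩ := mem_cut.1 hcF
    exact ⟨s, by simp [hs, hc], hs, rfl, hne⟩
  · rintro ⟨d, hd, hdF, rfl, hne⟩
    exact ⟨(Finset.mem_filter.1 hd).2, mem_cut.2 ⟨d, hdF, rfl, hne⟩⟩

/-- If no edge of `E` is used by `G`, then `G` is a subforest of `F.cut E`. -/
theorem subforest_cut {F G : XForest X} {E : Finset (Finset X)}
    (h : XForest.IsSubforest G F)
    (hE : ∀ e ∈ E, e ∈ F.clusters → ∀ t ∈ G.clusters, ∀ z ∈ t, z ∈ e → t ⊆ e) :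
    XForest.IsSubforest G (F.cut E) := by
  obtain ⟨D, hD, hG⟩ := h
  have h1 : G.clusters = (F.cut (D ∪ E)).clusters := by
    have hsub : ∀ s y, y ∈ rest F (D ∪ E) s ↔ y ∈ rest F D s ∧
        ∀ e ∈ E, e ∈ F.clusters → y ∈ e → s ⊆ e := by
      intro s y
      simp only [mem_rest, Finset.mem_union]
      constructor
      · rintro ⟨h1, h2⟩
        exact ⟨⟨h1, fun d hd => h2 d (Or.inl hd)⟩, fun d hd => h2 d (Or.inr hd)⟩
      · rintro ⟨⟨h1, h2⟩, h3⟩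
        exact ⟨h1, fun d hd => hd.elim (h2 d) (h3 d)⟩
    have hE' : ∀ e ∈ E, e ∈ F.clusters → ∀ s ∈ F.clusters, ∀ z ∈ rest F D s, z ∈ e →
        rest F D s ⊆ e := by
      intro e he heF s hs z hz hze
      exact hE e he heF _ (hG ▸ mem_cut.2 ⟨s, hs, rfl, z, hz⟩) z hz hze
    rw [hG]
    ext t
    rw [mem_cut, mem_cut]
    constructor
    · rintro ⟨s, hs, rfl, hne⟩
      obtain ⟨t, ht, hts, hmin⟩ := exists_min D hs
      refine ⟨t, ht, ?_, hne⟩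
      rw [← hts]
      ext y
      rw [hsub]
      refine and_iff_left_of_imp fun hy e he heF hye => ?_
      rcases lam ht heF (mem_rest.1 hy).1 hye with h1 | h1
      · exact h1
      · by_contra hc
        have hte := hE' e he heF t ht y hy hye
        have hed : ∀ w ∈ rest F D t, w ∈ rest F D e := by
          intro w hw
          refine mem_rest.2 ⟨hte hw, fun d hd hdF hwd => ?_⟩
          exact h1.trans ((mem_rest.1 hw).2 d hd hdF hwd)
        refine hmin e heF ⟨h1, hc⟩ ?_
        rw [← hts]
        exact Finset.Subset.antisymm (rest_mono heF h1 (hed y hy) hy) hed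
    · rintro ⟨s, hs, rfl, z, hz⟩
      refine ⟨s, hs, ?_, z, hz⟩
      rw [hsub] at hz
      ext y
      rw [hsub]
      refine (and_iff_left_of_imp fun hy e he heF hye => ?_).symm
      exact hz.2 e he heF (hE' e he heF s hs y hy hye hz.1)
  refine ⟨(F.cut E).clusters.filter fun c => ∃ d ∈ D, rest F E d = c,
    Finset.filter_subset _ _, ?_⟩
  rw [h1]
  symm
  apply cut_cut
  intro c
  simp only [Finset.mem_filter]
  constructor
  · rintro ⟨⟨hc, d, hd, rfl⟩, -⟩
    refine ⟨d, hd, hD hd, rfl, (F.cut E).nonempty_of_mem _ hc⟩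
  · rintro ⟨d, hd, hdF, rfl, hne⟩
    have := mem_cut.2 ⟨d, hdF, rfl, hne⟩
    exact ⟨⟨this, d, hd, rfl⟩, this⟩

theorem mem_components {F : XForest X} {C : Finset X} :
    C ∈ F.components ↔ C ∈ F.clusters ∧ ∀ t ∈ F.clusters, ¬C ⊂ t := by
  simp [XForest.components]

theorem comp_max {F : XForest X} {C s : Finset X} (hC : C ∈ F.components)
    (hs : s ∈ F.clusters) {y : X} (h1 : y ∈ C) (h2 : y ∈ s) : s ⊆ C := by
  rw [mem_components] at hC
  rcases lam hC.1 hs h1 h2 with h | h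
  · by_contra hc
    exact hC.2 s hs ⟨h, hc⟩
  · exact h

theorem ord_cut (F : XForest X) (E : Finset (Finset X)) (hE : E ⊆ F.clusters)
    (hdis : ∀ e ∈ E, ∀ e' ∈ E, ∀ y, y ∈ e → y ∈ e' → e = e')
    (hroot : ∀ e ∈ E, ∃ t ∈ F.clusters, e ⊂ t)
    (hne : ∀ C ∈ F.components, (rest F E C).Nonempty) :
    F.ord + E.card ≤ (F.cut E).ord := by
  have hEr : ∀ e ∈ E, rest F E e = e := by
    intro e he
    ext y
    rw [mem_rest]
    refine and_iff_left_of_imp fun hy d hd _ hyd => ?_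
    rw [hdis e he d hd y hy hyd]
  have hinj : Set.InjOn (rest F E) (F.components : Set (Finset X)) := by
    intro C hC C' hC' h
    obtain ⟨z, hz⟩ := hne C hC
    have hz' : z ∈ rest F E C' := h ▸ hz
    rw [mem_rest] at hz hz'
    exact Finset.Subset.antisymm
      (comp_max hC' (mem_components.1 hC).1 hz'.1 hz.1)
      (comp_max hC (mem_components.1 hC').1 hz.1 hz'.1)
  have hdisj : Disjoint (F.components.image (rest F E)) E := by
    rw [Finset.disjoint_left]
    intro c hc hcE
    obtain ⟨C, hC, rfl⟩ := Finset.mem_image.1 hc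
    obtain ⟨z, hz⟩ := hne C hC
    have hCe := (mem_rest.1 hz).2 _ hcE (hE hcE) hz
    obtain ⟨t, ht, hlt⟩ := hroot _ hcE
    have hss : C ⊂ t := lt_of_le_of_lt hCe hlt
    exact (mem_components.1 hC).2 t ht hss
  have hsub : F.components.image (rest F E) ∪ E ⊆ (F.cut E).components := by
    intro c hc
    rw [mem_components]
    rcases Finset.mem_union.1 hc with hc | hc
    · obtain ⟨C, hC, rfl⟩ := Finset.mem_image.1 hc
      obtain ⟨z, hz⟩ := hne C hC
      refine ⟨mem_cut.2 ⟨C, (mem_components.1 hC).1, rfl, z, hz⟩, fun t ht hlt => ?_⟩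
      obtain ⟨s, hs, rfl, -⟩ := mem_cut.1 ht
      have hzs := hlt.1 hz
      exact hlt.2 (rest_mono hs (comp_max hC hs (mem_rest.1 hz).1 (mem_rest.1 hzs).1) hzs hz)
    · obtain ⟨z, hz⟩ := F.nonempty_of_mem c (hE hc)
      refine ⟨mem_cut.2 ⟨c, hE hc, hEr c hc, z, hz⟩, fun t ht hlt => ?_⟩
      obtain ⟨s, hs, rfl, -⟩ := mem_cut.1 ht
      have hzs := mem_rest.1 (hlt.1 hz)
      refine hlt.2 (Finset.Subset.trans ?_ (hzs.2 c hc (hE hc) hz))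
      exact fun y hy => (mem_rest.1 hy).1
  calc F.ord + E.card = (F.components.image (rest F E) ∪ E).card := by
        rw [Finset.card_union_of_disjoint hdisj, Finset.card_image_of_injOn hinj]; rfl
    _ ≤ (F.cut E).ord := Finset.card_le_card hsub

/-- a cluster containing a child of `L` together with something else contains `L`. -/
theorem child_up {F : XForest X} {c L s : Finset X} (h : F.IsChild c L)
    (hs : s ∈ F.clusters) (hcs : c ⊂ s) : L ⊆ s := by
  obtain ⟨hc, hL, hcL, hb⟩ := h
  obtain ⟨y, hy⟩ := F.nonempty_of_mem c hc
  rcases lam hL hs (hcL.1 hy) (hcs.1 hy) with h1 | h1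
  · exact h1
  · by_contra hcon
    exact hb s hs hcs ⟨h1, hcon⟩

theorem ordMax_eq {m : ℕ} {I : Inst X m} (hiso : InstLabelIso I) (i : Fin m) :
    I.ordMax = (I.F i).ord := by
  unfold Inst.ordMax
  apply le_antisymm
  · refine Finset.sup_le fun j _ => ?_
    have := hiso j i
    unfold LabelIso at this
    unfold XForest.ord
    rw [this]
  · exact Finset.le_sup (f := fun i => (I.F i).ord) (Finset.mem_univ i)

theorem le_ordMax {m : ℕ} (I : Inst X m) (i : Fin m) : (I.F i).ord ≤ I.ordMax :=
  Finset.le_sup (f := fun i => (I.F i).ord) (Finset.mem_univ i)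

end

theorem rec_aux (T : ℤ → ℝ) (h0 : ∀ x, 0 ≤ T x)
    (hT : ∀ x : ℤ, ((2 : ℕ) : ℝ) * T (x - 1) + ((1 : ℕ) : ℝ) * T (x - 2) ≤ T x)
    (k : ℤ) (n : ℕ) : ((n : ℝ) + 3) * T (k - 2 - n) ≤ 3 * T (k - 2) := by
  induction n with
  | zero => simp
  | succ n ih =>
    refine le_trans ?_ ih
    have h1 := hT (k - 2 - n)
    have e : k - 2 - ((n + 1 : ℕ) : ℤ) = k - 2 - n - 1 := by push_cast; ring
    rw [e]
    have h2 := h0 (k - 2 - n - 1)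
    have h3 := h0 (k - 2 - n - 2)
    push_cast at *
    nlinarith [mul_nonneg (Nat.cast_nonneg (α := ℝ) n) h2,
      mul_nonneg (Nat.cast_nonneg (α := ℝ) n) h3]

end BR33

/-- Lemma 4.10, Branching Rule 3.3.  Let `(F_1, …, F_m; k)`
satisfy the label-set isomorphism property with `S` a minimum MSS lying in
`F_1`, `|S| ≥ 3`, such that `|E^1_F(x,x')| ≤ 1` for every forest `F` of the
instance and all `x, x' ∈ S` (Case 3.3).  Let `𝒞₂` be the nonempty collection
of forests in which not all labels of `S` are children of `lca_F(S)`; for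
`F ∈ 𝒞₂`, `x₁` is the unique grandchild-label of `lca_F(S)`, `v_F` the vertex
sharing a parent with `x₁`, and `e_F` the edge between `v_F` and its parent.
Then Branching Rule 3.3 — [1] remove the edge `e_F` for each `F ∈ 𝒞₂`;
[1+i] for each `x_i ∈ S`, remove the edges incident to the labels of
`S ∖ {x_i}` in all forests — is safe and satisfies the recurrence relation
`T(k) ≤ 2·T(k-1) + T(k-2)`. -/
theorem statement_16 {X : Type*} [DecidableEq X] [Fintype X] {m : ℕ} (hm : 0 < m)
    (I I₀ : Inst X m) (Ib : X → Inst X m)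
    (S : Finset X) (hS3 : 3 ≤ S.card)
    (hiso : InstLabelIso I)
    (hMSS : I.MinMSS ⟨0, hm⟩ S)
    (hE1 : ∀ i : Fin m, ∀ x ∈ S, ∀ x' ∈ S, ((I.F i).E1 x x').card ≤ 1)
    (C2 : Finset (Fin m))
    (hC2 : ∀ i, i ∈ C2 ↔ ¬∀ x ∈ S, (I.F i).IsChild {x} ((I.F i).lcaS S))
    (hC2ne : C2.Nonempty)
    (x₁ : Fin m → X) (vF : Fin m → Finset X)
    (hstruct : ∀ i ∈ C2, x₁ i ∈ S ∧ ∃ p ∈ (I.F i).clusters,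
      p ≠ (I.F i).lcaS S ∧ (I.F i).IsChild p ((I.F i).lcaS S) ∧
      (I.F i).IsChild {x₁ i} p ∧ (I.F i).IsChild (vF i) p ∧ vF i ≠ {x₁ i} ∧
      (∀ c, (I.F i).IsChild c p → c = {x₁ i} ∨ c = vF i) ∧
      ∀ x ∈ S.erase (x₁ i), (I.F i).IsChild {x} ((I.F i).lcaS S))
    (hI₀F : I₀.F = fun i => if i ∈ C2 then (I.F i).cut {vF i} else I.F i)
    (hI₀k : I₀.k = I.k + I.ordMax - I₀.ordMax)
    (hIbF : ∀ x ∈ S,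
      (Ib x).F = fun i => (I.F i).cut ((S.erase x).image fun y => ({y} : Finset X)))
    (hIbk : ∀ x ∈ S, (Ib x).k = I.k + I.ordMax - (Ib x).ordMax) :
    (I.IsYes ↔ I₀.IsYes ∨ ∃ x ∈ S, (Ib x).IsYes) ∧
    RecBound I.k (I₀.k :: (S.toList.map fun x => (Ib x).k)) 2 1 := by
  have hMS := hMSS.1
  -- structure of `vF`
  have hvF : ∀ i ∈ C2, ∃ p, p ∈ (I.F i).clusters ∧ (I.F i).IsChild p ((I.F i).lcaS S) ∧
      (I.F i).IsChild {x₁ i} p ∧ (I.F i).IsChild (vF i) p ∧ x₁ i ∉ vF i ∧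
      (∀ w ∈ p, w ≠ x₁ i → w ∈ vF i) ∧ (∀ w ∈ S, w ≠ x₁ i → w ∉ p) := by
    intro i hi
    obtain ⟨-, p, hp, -, hpL, hxp, hvp, hne, hch, hS⟩ := hstruct i hi
    refine ⟨p, hp, hpL, hxp, hvp, ?_, ?_, ?_⟩
    · intro hx
      exact hxp.2.2.2 (vF i) hvp.1 (Finset.ssubset_iff_subset_ne.2
        ⟨Finset.singleton_subset_iff.2 hx, hne.symm⟩) hvp.2.2.1
    · intro w hw hwx
      have hxmem : x₁ i ∈ p := hxp.2.2.1.1 (Finset.mem_singleton_self _)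
      have hwp : ({w} : Finset X) ⊂ p := Finset.ssubset_iff_subset_ne.2
        ⟨Finset.singleton_subset_iff.2 hw, fun h => hwx
          (Finset.mem_singleton.1 (h ▸ hxmem)).symm⟩
      classical
      obtain ⟨c, hc, hmax⟩ := ((I.F i).clusters.filter fun c => w ∈ c ∧ c ⊂ p).exists_max_image
        Finset.card ⟨{w}, Finset.mem_filter.2
          ⟨(I.F i).singleton_mem w, Finset.mem_singleton_self w, hwp⟩⟩
      rw [Finset.mem_filter] at hc
      have hcc : (I.F i).IsChild c p := by
        refine ⟨hc.1, hp, hc.2.2, fun t ht hct htp => ?_⟩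
        have := hmax t (Finset.mem_filter.2 ⟨ht, hct.1 hc.2.1, htp⟩)
        have := Finset.card_lt_card hct
        omega
      rcases hch c hcc with h | h
      · exact absurd (Finset.mem_singleton.1 (h ▸ hc.2.1)) hwx
      · exact h ▸ hc.2.1
    · intro w hw hwx hwp
      have hxmem : x₁ i ∈ p := hxp.2.2.1.1 (Finset.mem_singleton_self _)
      have hwc := hS w (Finset.mem_erase.2 ⟨hwx, hw⟩)
      refine hwc.2.2.2 p hp (Finset.ssubset_iff_subset_ne.2
        ⟨Finset.singleton_subset_iff.2 hwp, fun h => hwx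
          (Finset.mem_singleton.1 (h ▸ hxmem)).symm⟩) hpL.2.2.1
  have hyS : ∀ s ∈ (I.F ⟨0, hm⟩).clusters, ∀ y ∈ S, y ∈ s → s ≠ {y} → S ⊆ s := by
    intro s hs y hy hys hsy
    rcases BR33.lam hMS.1 hs hy hys with h | h
    · exact h
    · by_contra hc
      have h1 := hMS.2.2 s hs ⟨h, hc⟩
      obtain ⟨a, rfl⟩ := Finset.card_eq_one.1 h1
      exact hsy (by rw [Finset.mem_singleton.1 hys])
  constructor
  · have th0 : (I₀.ordMax : ℤ) + I₀.k = I.ordMax + I.k := by rw [hI₀k]; ring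
    have thb : ∀ x ∈ S, ((Ib x).ordMax : ℤ) + (Ib x).k = I.ordMax + I.k := by
      intro x hx; rw [hIbk x hx]; ring
    constructor
    · rintro ⟨G, hG, hord⟩
      by_cases hA : ∃ x ∈ S, ∀ y ∈ S, y ≠ x → ∀ t ∈ G.clusters, y ∈ t → t = {y}
      · obtain ⟨x, hx, hA⟩ := hA
        refine Or.inr ⟨x, hx, G, fun i => ?_, by rw [thb x hx]; exact hord⟩
        rw [hIbF x hx]
        refine BR33.subforest_cut (hG i) ?_
        intro e he _ t ht z hz hze
        obtain ⟨y, hy, rfl⟩ := Finset.mem_image.1 he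
        rw [Finset.mem_erase] at hy
        rw [Finset.mem_singleton] at hze
        subst hze
        rw [hA z hy.2 hy.1 t ht hz]
      · push Not at hA
        refine Or.inl ⟨G, fun i => ?_, by rw [th0]; exact hord⟩
        rw [hI₀F]
        by_cases hi : i ∈ C2
        swap
        · simp only [hi, if_false]; exact hG i
        simp only [hi, if_true]
        refine BR33.subforest_cut (hG i) ?_
        intro e he heF t ht z hz hze
        rw [Finset.mem_singleton] at he
        subst he
        -- the cluster `Q` of `G`
        obtain ⟨D₁, -, hG1⟩ := hG ⟨0, hm⟩
        have hQ : ∀ u ∈ S, ∀ t ∈ G.clusters, u ∈ t → t ≠ {u} →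
            u ∈ BR33.rest (I.F ⟨0, hm⟩) D₁ S := by
          intro u hu t ht hut htu
          rw [hG1] at ht
          obtain ⟨s, hs, rfl, -⟩ := BR33.mem_cut.1 ht
          have hu' := BR33.mem_rest.1 hut
          have hsu : s ≠ {u} := by
            rintro rfl
            refine htu (Finset.Subset.antisymm (fun w hw => (BR33.mem_rest.1 hw).1) ?_)
            exact Finset.singleton_subset_iff.2 hut
          have hSs := hyS s hs u hu hu'.1 hsu
          exact BR33.mem_rest.2 ⟨hu, fun d hd hdF hud => hSs.trans (hu'.2 d hd hdF hud)⟩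
        set Q := BR33.rest (I.F ⟨0, hm⟩) D₁ S with hQdef
        have hQS : Q ⊆ S := fun w hw => (BR33.mem_rest.1 hw).1
        obtain ⟨x0, hx0⟩ : S.Nonempty := Finset.card_pos.1 (by omega)
        obtain ⟨y, hyS', hyx, ty, hty, hyty, htyne⟩ := hA (x₁ i) (hstruct i hi).1
        obtain ⟨y', hy'S, hy'y, ty', hty', hyty', htyne'⟩ := hA y hyS'
        have hyQ : y ∈ Q := hQ y hyS' ty hty hyty htyne
        have hy'Q : y' ∈ Q := hQ y' hy'S ty' hty' hyty' htyne'
        have hQG : Q ∈ G.clusters := by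
          rw [hG1]; exact BR33.mem_cut.2 ⟨S, hMS.1, rfl, y, hyQ⟩
        obtain ⟨p, hp, hpL, hxp, hvp, hxv, hpv, hSp⟩ := hvF i hi
        obtain ⟨-, -, -, -, -, -, -, -, -, hSL⟩ := hstruct i hi
        have hyL := hSL y (Finset.mem_erase.2 ⟨hyx, hyS'⟩)
        set L := (I.F i).lcaS S with hLdef
        have hvS : ∀ w ∈ vF i, w ∉ S := by
          intro w hw hwS
          by_cases hwx : w = x₁ i
          · exact hxv (hwx ▸ hw)
          · exact hSp w hwS hwx (hvp.2.2.1.1 hw)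
        obtain ⟨D, -, hGi⟩ := hG i
        have hLQ : BR33.rest (I.F i) D L ⊆ Q := by
          have hq := hQG
          rw [hGi] at hq
          obtain ⟨q, hqF, hqQ, -⟩ := BR33.mem_cut.1 hq
          have hyq := hyQ
          have hy'q := hy'Q
          rw [← hqQ] at hyq hy'q
          have h1 := BR33.mem_rest.1 hyq
          have h2 := BR33.mem_rest.1 hy'q
          have hLq : L ⊆ q := by
            refine BR33.child_up hyL hqF (Finset.ssubset_iff_subset_ne.2
              ⟨Finset.singleton_subset_iff.2 h1.1, fun h => hy'y ?_⟩)
            exact Finset.mem_singleton.1 (h ▸ h2.1)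
          intro w hw
          have hw' := BR33.mem_rest.1 hw
          rw [← hqQ]
          refine BR33.mem_rest.2 ⟨hLq hw'.1, fun d hd hdF hwd => ?_⟩
          have hLd := hw'.2 d hd hdF hwd
          exact h1.2 d hd hdF (hLd (hyL.2.2.1.1 (Finset.mem_singleton_self y)))
        have ht' := ht
        rw [hGi] at ht'
        obtain ⟨s, hs, hst, -⟩ := BR33.mem_cut.1 ht'
        have hts : t ⊆ s := fun w hw => (BR33.mem_rest.1 (hst ▸ hw)).1
        rcases BR33.lam hs heF (hts hz) hze with h1 | h1
        · exact hts.trans h1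
        by_cases hsv : s ⊆ vF i
        · exact hts.trans hsv
        have hps : p ⊆ s := BR33.child_up hvp hs ⟨h1, hsv⟩
        have hzs : z ∈ BR33.rest (I.F i) D s := hst ▸ hz
        by_cases hsp : s ⊆ p
        · by_cases hxt : x₁ i ∈ t
          · exfalso
            have htx : t ≠ {x₁ i} := by
              intro h
              have := Finset.mem_singleton.1 (h ▸ hz)
              exact hxv (this ▸ hze)
            have hxQ := hQ _ (hstruct i hi).1 t ht hxt htx
            rcases BR33.lam ht hQG hxt hxQ with h | h
            · exact hvS z hze (hQS (h hz))
            · exact hSp y hyS' hyx (hsp (hts (h hyQ)))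
          · intro w hw
            exact hpv w (hsp (hts hw)) (fun h => hxt (h ▸ hw))
        · exfalso
          have hLs : L ⊆ s := BR33.child_up hpL hs ⟨hps, hsp⟩
          have hzL : z ∈ BR33.rest (I.F i) D L := by
            refine BR33.mem_rest.2 ⟨hpL.2.2.1.1 (hvp.2.2.1.1 hze), fun d hd hdF hzd => ?_⟩
            exact hLs.trans ((BR33.mem_rest.1 hzs).2 d hd hdF hzd)
          exact hvS z hze (hQS (hLQ hzL))
    · rintro (⟨G, hG, hord⟩ | ⟨x, hx, G, hG, hord⟩)
      · refine ⟨G, fun i => ?_, by rw [← th0]; exact hord⟩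
        have := hG i
        rw [hI₀F] at this
        by_cases hi : i ∈ C2
        · simp only [hi, if_true] at this
          exact BR33.subforest_of_cut this
        · simpa only [hi, if_false] using this
      · refine ⟨G, fun i => ?_, by rw [← thb x hx]; exact hord⟩
        have := hG i
        rw [hIbF x hx] at this
        exact BR33.subforest_of_cut this
  · have hk0 : I₀.k ≤ I.k - 1 := by
      obtain ⟨i, hi⟩ := hC2ne
      obtain ⟨p, hp, hpL, hxp, hvp, hxv, hpv, hSp⟩ := hvF i hi
      have h1 : (I.F i).ord + ({vF i} : Finset (Finset X)).card ≤ ((I.F i).cut {vF i}).ord := by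
        apply BR33.ord_cut
        · exact Finset.singleton_subset_iff.2 hvp.1
        · intro e he e' he' _ _ _
          rw [Finset.mem_singleton.1 he, Finset.mem_singleton.1 he']
        · intro e he
          rw [Finset.mem_singleton.1 he]
          exact ⟨p, hp, hvp.2.2.1⟩
        · intro C hC
          have hCF := (BR33.mem_components.1 hC).1
          by_cases hCv : C ⊆ vF i
          · obtain ⟨z, hz⟩ := (I.F i).nonempty_of_mem C hCF
            refine ⟨z, BR33.mem_rest.2 ⟨hz, fun d hd _ _ => ?_⟩⟩
            rw [Finset.mem_singleton.1 hd]; exact hCv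
          · obtain ⟨z, hz, hzv⟩ := Finset.not_subset.1 hCv
            refine ⟨z, BR33.mem_rest.2 ⟨hz, fun d hd _ hzd => ?_⟩⟩
            rw [Finset.mem_singleton.1 hd] at hzd
            exact absurd hzd hzv
      have h2 := BR33.le_ordMax I₀ i
      rw [hI₀F] at h2
      simp only [hi, if_true] at h2
      have h3 := BR33.ordMax_eq hiso i
      rw [Finset.card_singleton] at h1
      omega
    have hkb : ∀ x ∈ S, (Ib x).k ≤ I.k - 2 - ((S.card - 3 : ℕ) : ℤ) := by
      intro x hx
      set E := (S.erase x).image fun y => ({y} : Finset X) with hE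
      have hcard : E.card = S.card - 1 := by
        rw [hE, Finset.card_image_of_injective _ Finset.singleton_injective,
          Finset.card_erase_of_mem hx]
      have hmem : ∀ e ∈ E, ∃ y ∈ S, y ≠ x ∧ e = {y} := by
        intro e he
        obtain ⟨y, hy, rfl⟩ := Finset.mem_image.1 he
        rw [Finset.mem_erase] at hy
        exact ⟨y, hy.2, hy.1, rfl⟩
      have h1 : (I.F ⟨0, hm⟩).ord + E.card ≤ ((I.F ⟨0, hm⟩).cut E).ord := by
        apply BR33.ord_cut
        · intro e he
          obtain ⟨y, -, -, rfl⟩ := hmem e he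
          exact XForest.singleton_mem _ y
        · intro e he e' he' w hw hw'
          obtain ⟨y, -, -, rfl⟩ := hmem e he
          obtain ⟨y', -, -, rfl⟩ := hmem e' he'
          rw [← Finset.mem_singleton.1 hw, ← Finset.mem_singleton.1 hw']
        · intro e he
          obtain ⟨y, hy, hyx, rfl⟩ := hmem e he
          refine ⟨S, hMS.1, Finset.ssubset_iff_subset_ne.2
            ⟨Finset.singleton_subset_iff.2 hy, fun h => ?_⟩⟩
          rw [← h, Finset.card_singleton] at hS3
          omega
        · intro C hC
          have hCF := (BR33.mem_components.1 hC).1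
          obtain ⟨z, hz⟩ := XForest.nonempty_of_mem _ C hCF
          by_cases hzS : z ∈ S
          · have hSC := BR33.comp_max hC hMS.1 hz hzS
            refine ⟨x, BR33.mem_rest.2 ⟨hSC hx, fun d hd _ hxd => ?_⟩⟩
            obtain ⟨y, hy, hyx, rfl⟩ := hmem d hd
            exact absurd (Finset.mem_singleton.1 hxd).symm hyx
          · refine ⟨z, BR33.mem_rest.2 ⟨hz, fun d hd _ hzd => ?_⟩⟩
            obtain ⟨y, hy, hyx, rfl⟩ := hmem d hd
            exact absurd ((Finset.mem_singleton.1 hzd) ▸ hy) hzS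
      have h2 := BR33.le_ordMax (Ib x) ⟨0, hm⟩
      rw [hIbF x hx] at h2
      have h3 := BR33.ordMax_eq hiso ⟨0, hm⟩
      have h4 := hIbk x hx
      change ((I.F ⟨0, hm⟩).cut E).ord ≤ _ at h2
      omega
    intro T h0 hmono hT
    rw [List.map_cons, List.sum_cons, List.map_map]
    have hsum : (S.toList.map (T ∘ fun x => (Ib x).k)).sum = ∑ x ∈ S, T (Ib x).k :=
      Finset.sum_map_toList S _
    rw [hsum]
    have hle : ∑ x ∈ S, T (Ib x).k ≤ S.card • T (I.k - 2 - ((S.card - 3 : ℕ) : ℤ)) :=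
      Finset.sum_le_card_nsmul _ _ _ fun x hx => hmono (hkb x hx)
    have haux := BR33.rec_aux T h0 hT I.k (S.card - 3)
    rw [nsmul_eq_mul] at hle
    have hc : (((S.card - 3 : ℕ) : ℝ) + 3) = S.card := by
      have : (S.card - 3) + 3 = S.card := by omega
      exact_mod_cast this
    rw [hc] at haux
    have h5 := hmono hk0
    have h6 := hT I.k
    have h7 := hT (I.k - 1)
    have h8 := h0 (I.k - 1 - 2)
    have e : I.k - 1 - 1 = I.k - 2 := by ring
    rw [e] at h7
    push_cast at h6 h7
    linarith
end
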